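/- Let d ≥ 3. There exist η₀ > 0 depending only on d and a universal constant C ≥ 1 such that: if v is a solution of the hodograph PDE on H₁ = {y : y_d ≥ 0, |y| ≥ 1} with |∇v(y)| ≤ η₀ on H₁, and v is bounded from above or bounded from below, then v is bounded on H₁, the limit v_∞ := lim_{|y|→∞, y∈H₁} v(y) exists, and max_{∂B₁⁺} v − C·(max_{∂B₁⁺} v − max_{∂B₂⁺} v)₊ ≤ v_∞ ≤ min_{∂B₁⁺} v + C·(min_{∂B₂⁺} v − min_{∂B₁⁺} v)₊, where (t)₊ = max(t,0). -/

import Mathlib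

open Real Set Filter MeasureTheory

noncomputable section

/-- The last index of `Fin d`. -/
def lastIdx (d : ℕ) (hd : 0 < d) : Fin d := ⟨d - 1, by omega⟩

/-- The `i`-th partial derivative of `v` at `y`. -/
def gradC (d : ℕ) (v : EuclideanSpace ℝ (Fin d) → ℝ)
    (y : EuclideanSpace ℝ (Fin d)) (i : Fin d) : ℝ :=
  fderiv ℝ v y (EuclideanSpace.single i 1)

/-- The `(i,j)` entry of the Hessian of `v` at `y`. -/
def hessC (d : ℕ) (v : EuclideanSpace ℝ (Fin d) → ℝ)
    (y : EuclideanSpace ℝ (Fin d)) (i j : Fin d) : ℝ :=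
  fderiv ℝ (fun z => fderiv ℝ v z (EuclideanSpace.single i 1)) y (EuclideanSpace.single j 1)

/-- The squared euclidean norm of the tangential part `p'` of `p`. -/
def tangSq (d : ℕ) (hd : 0 < d) (p : Fin d → ℝ) : ℝ :=
  ∑ m : Fin d, if m = lastIdx d hd then 0 else (p m) ^ 2

/-- The coefficient matrix `A(p)` of the hodograph PDE. -/
def hodA (d : ℕ) (hd : 0 < d) (p : Fin d → ℝ) (i j : Fin d) : ℝ :=
  if i = lastIdx d hd then
    (if j = lastIdx d hd then (1 + tangSq d hd p) / (1 + p (lastIdx d hd)) ^ 2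
     else p j / (1 + p (lastIdx d hd)))
  else
    (if j = lastIdx d hd then p i / (1 + p (lastIdx d hd))
     else if i = j then 1 else 0)

/-- The boundary nonlinearity `N(p') = √(1 + |p'|²) - 1`. -/
def hodN (d : ℕ) (hd : 0 < d) (p : Fin d → ℝ) : ℝ :=
  Real.sqrt (1 + tangSq d hd p) - 1

/-- The quantity `tr(A(∇v(y)) D²v(y))`. -/
def hodOp (d : ℕ) (hd : 0 < d) (v : EuclideanSpace ℝ (Fin d) → ℝ)
    (y : EuclideanSpace ℝ (Fin d)) : ℝ :=
  ∑ i : Fin d, ∑ j : Fin d, hodA d hd (fun m => gradC d v y m) i j * hessC d v y i j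

/-- `v` is `C^∞` on an open neighborhood of `U`. -/
def SmoothNear (d : ℕ) (v : EuclideanSpace ℝ (Fin d) → ℝ)
    (U : Set (EuclideanSpace ℝ (Fin d))) : Prop :=
  ∃ W : Set (EuclideanSpace ℝ (Fin d)), IsOpen W ∧ U ⊆ W ∧ ContDiffOn ℝ (⊤ : ℕ∞) v W

/-- `v` is a (classical) solution of the hodograph PDE on `U`. -/
def IsHodSol (d : ℕ) (hd : 0 < d) (v : EuclideanSpace ℝ (Fin d) → ℝ)
    (U : Set (EuclideanSpace ℝ (Fin d))) : Prop :=
  SmoothNear d v U ∧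
  (∀ y ∈ U, 0 < y (lastIdx d hd) → hodOp d hd v y = 0) ∧
  (∀ y ∈ U, y (lastIdx d hd) = 0 →
    gradC d v y (lastIdx d hd) = hodN d hd (fun m => gradC d v y m))

/-- `v` is a subsolution of the hodograph PDE on `U`. -/
def IsHodSubsol (d : ℕ) (hd : 0 < d) (v : EuclideanSpace ℝ (Fin d) → ℝ)
    (U : Set (EuclideanSpace ℝ (Fin d))) : Prop :=
  SmoothNear d v U ∧
  (∀ y ∈ U, 0 < y (lastIdx d hd) → 0 ≤ hodOp d hd v y) ∧
  (∀ y ∈ U, y (lastIdx d hd) = 0 →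
    hodN d hd (fun m => gradC d v y m) ≤ gradC d v y (lastIdx d hd))

/-- `v` is a supersolution of the hodograph PDE on `U`. -/
def IsHodSupersol (d : ℕ) (hd : 0 < d) (v : EuclideanSpace ℝ (Fin d) → ℝ)
    (U : Set (EuclideanSpace ℝ (Fin d))) : Prop :=
  SmoothNear d v U ∧
  (∀ y ∈ U, 0 < y (lastIdx d hd) → hodOp d hd v y ≤ 0) ∧
  (∀ y ∈ U, y (lastIdx d hd) = 0 →
    gradC d v y (lastIdx d hd) ≤ hodN d hd (fun m => gradC d v y m))

/-- The exterior half-space domain `H₁ = {y : y_d ≥ 0, |y| ≥ 1}`. -/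
def extDom (d : ℕ) (hd : 0 < d) : Set (EuclideanSpace ℝ (Fin d)) :=
  {y | 0 ≤ y (lastIdx d hd) ∧ 1 ≤ ‖y‖}

/-- The half annulus `A_r = {y : 1 ≤ |y| ≤ r, y_d ≥ 0}`. -/
def halfAnn (d : ℕ) (hd : 0 < d) (r : ℝ) : Set (EuclideanSpace ℝ (Fin d)) :=
  {y | 0 ≤ y (lastIdx d hd) ∧ 1 ≤ ‖y‖ ∧ ‖y‖ ≤ r}

/-- The upper half sphere `∂B_ρ⁺ = {y : y_d ≥ 0, |y| = ρ}`. -/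
def upSphere (d : ℕ) (hd : 0 < d) (ρ : ℝ) : Set (EuclideanSpace ℝ (Fin d)) :=
  {y | 0 ≤ y (lastIdx d hd) ∧ ‖y‖ = ρ}

/-- The filter of `|y| → ∞` within `H₁`. -/
def farFilter (d : ℕ) (hd : 0 < d) : Filter (EuclideanSpace ℝ (Fin d)) :=
  (Filter.comap (fun y : EuclideanSpace ℝ (Fin d) => ‖y‖) Filter.atTop) ⊓
    Filter.principal (extDom d hd)

namespace Hodograph

open Topology

section Jets

variable {E : Type*} [NormedAddCommGroup E] [NormedSpace ℝ E]

/-- `t ↦ f (y + t • ξ)` is differentiable near `0` with derivative `a` at `0`, and has second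
derivative `b` at `0`. -/
def HasJet (f : E → ℝ) (y ξ : E) (a b : ℝ) : Prop :=
  ∃ φ : ℝ → ℝ, (∀ᶠ t in 𝓝 (0 : ℝ), HasDerivAt (fun t : ℝ => f (y + t • ξ)) (φ t) t) ∧
    φ 0 = a ∧ HasDerivAt φ b 0

lemma HasJet.hasDerivAt {f : E → ℝ} {y ξ : E} {a b : ℝ} (h : HasJet f y ξ a b) :
    HasDerivAt (fun t : ℝ => f (y + t • ξ)) a 0 := by
  obtain ⟨φ, h1, h2, -⟩ := h
  simpa [h2] using h1.self_of_nhds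

lemma HasJet.congr_val {f : E → ℝ} {y ξ : E} {a b a' b' : ℝ} (h : HasJet f y ξ a b)
    (ha : a = a') (hb : b = b') : HasJet f y ξ a' b' := ha ▸ hb ▸ h

lemma hasJet_const (c : ℝ) (y ξ : E) : HasJet (fun _ => c) y ξ 0 0 :=
  ⟨fun _ => 0, Eventually.of_forall fun t => hasDerivAt_const t c, rfl, hasDerivAt_const 0 0⟩

lemma HasJet.add {f g : E → ℝ} {y ξ : E} {a b a' b' : ℝ} (hf : HasJet f y ξ a b)
    (hg : HasJet g y ξ a' b') : HasJet (fun z => f z + g z) y ξ (a + a') (b + b') := by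
  obtain ⟨φ, h1, h2, h3⟩ := hf
  obtain ⟨ψ, k1, k2, k3⟩ := hg
  refine ⟨fun t => φ t + ψ t, ?_, by simp [h2, k2], h3.add k3⟩
  filter_upwards [h1, k1] with t ht kt using ht.add kt

lemma HasJet.mul {f g : E → ℝ} {y ξ : E} {a b a' b' : ℝ} (hf : HasJet f y ξ a b)
    (hg : HasJet g y ξ a' b') : HasJet (fun z => f z * g z) y ξ (a * g y + f y * a')
      (b * g y + 2 * a * a' + f y * b') := by
  have d1 := hf.hasDerivAt
  have d2 := hg.hasDerivAt
  obtain ⟨φ, h1, h2, h3⟩ := hf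
  obtain ⟨ψ, k1, k2, k3⟩ := hg
  refine ⟨fun t => φ t * g (y + t • ξ) + f (y + t • ξ) * ψ t, ?_, by simp [h2, k2], ?_⟩
  · filter_upwards [h1, k1] with t ht kt using ht.mul kt
  · refine ((h3.mul d2).add (d1.mul k3)).congr_deriv ?_
    simp [h2, k2]; ring

lemma HasJet.const_mul {f : E → ℝ} {y ξ : E} {a b : ℝ} (c : ℝ) (hf : HasJet f y ξ a b) :
    HasJet (fun z => c * f z) y ξ (c * a) (c * b) :=
  ((hasJet_const c y ξ).mul hf).congr_val (by ring) (by ring)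

lemma HasJet.sum {ι : Type*} {s : Finset ι} {f : ι → E → ℝ} {y ξ : E} {a b : ι → ℝ}
    (h : ∀ i ∈ s, HasJet (f i) y ξ (a i) (b i)) :
    HasJet (fun z => ∑ i ∈ s, f i z) y ξ (∑ i ∈ s, a i) (∑ i ∈ s, b i) := by
  classical
  induction s using Finset.induction_on with
  | empty => simpa using hasJet_const 0 y ξ
  | insert i s hi ih =>
    simp only [Finset.sum_insert hi]
    exact (h i (Finset.mem_insert_self i s)).add
      (ih fun j hj => h j (Finset.mem_insert_of_mem hj))

lemma HasJet.comp {f : E → ℝ} {y ξ : E} {a b : ℝ} (hf : HasJet f y ξ a b) {F F' : ℝ → ℝ}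
    {c : ℝ} (hF : ∀ᶠ x in 𝓝 (f y), HasDerivAt F (F' x) x) (hF' : HasDerivAt F' c (f y)) :
    HasJet (fun z => F (f z)) y ξ (F' (f y) * a) (c * a ^ 2 + F' (f y) * b) := by
  have d1 := hf.hasDerivAt
  obtain ⟨φ, h1, h2, h3⟩ := hf
  have hcont : Tendsto (fun t : ℝ => f (y + t • ξ)) (𝓝 0) (𝓝 (f y)) := by
    simpa using d1.continuousAt.tendsto
  refine ⟨fun t => F' (f (y + t • ξ)) * φ t, ?_, by simp [h2], ?_⟩
  · filter_upwards [h1, hcont.eventually hF] with t ht kt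
    exact kt.comp t ht
  · have e : f y = f (y + (0 : ℝ) • ξ) := by simp
    have hF'' : HasDerivAt F' c (f (y + (0 : ℝ) • ξ)) := by rwa [← e]
    refine ((hF''.comp (0 : ℝ) d1).mul h3).congr_deriv ?_
    simp [h2]; ring

lemma hasJet_clm (l : E →L[ℝ] ℝ) (y ξ : E) : HasJet (fun z => l z) y ξ (l ξ) 0 := by
  refine ⟨fun _ => l ξ, Eventually.of_forall fun t => ?_, rfl, hasDerivAt_const _ _⟩
  have : HasDerivAt (fun t : ℝ => l y + t * l ξ) (l ξ) t := by
    simpa using ((hasDerivAt_id t).mul_const (l ξ)).const_add (l y)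
  simpa using this

lemma hasJet_of_contDiffAt {f : E → ℝ} {y : E} (hf : ContDiffAt ℝ 2 f y) (ξ : E) :
    HasJet f y ξ (fderiv ℝ f y ξ) (fderiv ℝ (fun z => fderiv ℝ f z ξ) y ξ) := by
  have hl : ∀ t : ℝ, HasDerivAt (fun t : ℝ => y + t • ξ) ξ t := fun t => by
    simpa using ((hasDerivAt_id t).smul_const ξ).const_add y
  have hc : Tendsto (fun t : ℝ => y + t • ξ) (𝓝 0) (𝓝 y) := by
    simpa using (hl 0).continuousAt.tendsto
  refine ⟨fun t => fderiv ℝ f (y + t • ξ) ξ, ?_, by simp, ?_⟩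
  · have h2 : ∀ᶠ z in 𝓝 y, ContDiffAt ℝ 2 f z := hf.eventually (by simp)
    filter_upwards [hc.eventually h2] with t ht
    exact (ht.differentiableAt (by simp)).hasFDerivAt.comp_hasDerivAt t (hl t)
  · have h1 : ContDiffAt ℝ 1 (fderiv ℝ f) y := hf.fderiv_right (by norm_num)
    have h3 : DifferentiableAt ℝ (fun z => fderiv ℝ f z ξ) y :=
      (h1.differentiableAt (by simp)).clm_apply (differentiableAt_const ξ)
    have h4 : HasFDerivAt (fun z => fderiv ℝ f z ξ)
        (fderiv ℝ (fun z => fderiv ℝ f z ξ) y) (y + (0 : ℝ) • ξ) := by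
      simpa using h3.hasFDerivAt
    exact h4.comp_hasDerivAt (0 : ℝ) (hl 0)

lemma HasJet.nonpos_of_isLocalMax {f : E → ℝ} {y ξ : E} {a b : ℝ} (h : HasJet f y ξ a b)
    (hm : IsLocalMax f y) : b ≤ 0 := by
  by_contra! hb
  have d1 := h.hasDerivAt
  obtain ⟨φ, h1, h2, h3⟩ := h
  have hc : Tendsto (fun t : ℝ => y + t • ξ) (𝓝 0) (𝓝 y) := by
    have : Continuous (fun t : ℝ => y + t • ξ) := by fun_prop
    simpa using this.tendsto 0
  have hm' : IsLocalMax (fun t : ℝ => f (y + t • ξ)) 0 := by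
    have := hc.eventually hm
    simpa [IsLocalMax, IsMaxFilter] using this
  have he : deriv (fun t : ℝ => f (y + t • ξ)) =ᶠ[𝓝 0] φ := by
    filter_upwards [h1] with t ht using ht.deriv
  have hd : deriv (deriv (fun t : ℝ => f (y + t • ξ))) 0 = b := by
    rw [he.deriv_eq]; exact h3.deriv
  have hmin := isLocalMin_of_deriv_deriv_pos (by rw [hd]; exact hb) hm'.deriv_eq_zero
    d1.continuousAt
  have hconst : (fun t : ℝ => f (y + t • ξ)) =ᶠ[𝓝 0] fun _ => f (y + (0 : ℝ) • ξ) := by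
    filter_upwards [hm', hmin] with t h1 h2 using le_antisymm h1 h2
  have : deriv (deriv (fun t : ℝ => f (y + t • ξ))) 0 = 0 := by
    rw [hconst.deriv.deriv_eq]; simp
  linarith

lemma HasJet.nonpos_of_ray {f : E → ℝ} {y ξ : E} {a b : ℝ} (h : HasJet f y ξ a b)
    (hm : ∀ᶠ t in 𝓝[>] (0 : ℝ), f (y + t • ξ) ≤ f y) : a ≤ 0 := by
  have d1 := h.hasDerivAt
  have h2 : Tendsto (slope (fun t : ℝ => f (y + t • ξ)) 0) (𝓝[>] (0 : ℝ)) (𝓝 a) :=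
    (hasDerivAt_iff_tendsto_slope.1 d1).mono_left
      (nhdsWithin_mono 0 (fun t (ht : 0 < t) => ht.ne'))
  refine le_of_tendsto h2 ?_
  filter_upwards [hm, self_mem_nhdsWithin] with t ht (h0 : 0 < t)
  simp only [slope_def_field, zero_smul, add_zero, sub_zero]
  exact div_nonpos_of_nonpos_of_nonneg (by linarith) h0.le

end Jets

section JetsInner

variable {E : Type*} [NormedAddCommGroup E] [InnerProductSpace ℝ E]

lemma hasJet_normSq (x y ξ : E) :
    HasJet (fun z => ‖z - x‖ ^ 2) y ξ (2 * inner ℝ (y - x) ξ) (2 * ‖ξ‖ ^ 2) := by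
  have key : ∀ t : ℝ, ‖y + t • ξ - x‖ ^ 2 =
      ‖y - x‖ ^ 2 + t * (2 * inner ℝ (y - x) ξ) + t ^ 2 * ‖ξ‖ ^ 2 := fun t => by
    rw [show y + t • ξ - x = (y - x) + t • ξ by abel, norm_add_sq_real, inner_smul_right,
      norm_smul, mul_pow, Real.norm_eq_abs, sq_abs]
    ring
  refine ⟨fun t => 2 * inner ℝ (y - x) ξ + t * (2 * ‖ξ‖ ^ 2), Eventually.of_forall fun t => ?_,
    by simp, ?_⟩
  · simp only [key]
    have h1 := ((hasDerivAt_id t).mul_const (2 * inner ℝ (y - x) ξ)).const_add (‖y - x‖ ^ 2)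
    have h2 := (((hasDerivAt_id t).pow 2).mul_const (‖ξ‖ ^ 2))
    refine (h1.add h2).congr_deriv ?_
    simp; ring
  · simpa using ((hasDerivAt_id (0 : ℝ)).mul_const (2 * ‖ξ‖ ^ 2)).const_add
      (2 * inner ℝ (y - x) ξ)

lemma hasJet_norm {x y : E} (h : y ≠ x) (ξ : E) :
    HasJet (fun z => ‖z - x‖) y ξ (inner ℝ (y - x) ξ / ‖y - x‖)
      ((‖ξ‖ ^ 2 - (inner ℝ (y - x) ξ / ‖y - x‖) ^ 2) / ‖y - x‖) := by
  have hN : 0 < ‖y - x‖ := norm_pos_iff.2 (sub_ne_zero.2 h)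
  have hs : √(‖y - x‖ ^ 2) = ‖y - x‖ := Real.sqrt_sq hN.le
  have hpos : 0 < ‖y - x‖ ^ 2 := by positivity
  have h1 : ∀ᶠ s in 𝓝 (‖y - x‖ ^ 2), HasDerivAt (fun s : ℝ => √s) (1 / (2 * √s)) s := by
    filter_upwards [lt_mem_nhds hpos] with s hs' using Real.hasDerivAt_sqrt hs'.ne'
  have h2 : HasDerivAt (fun s : ℝ => 1 / (2 * √s)) (-(1 / (4 * ‖y - x‖ ^ 3))) (‖y - x‖ ^ 2) := by
    have := (((Real.hasDerivAt_sqrt hpos.ne').const_mul 2).inv (by rw [hs]; positivity))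
    refine (this.congr_of_eventuallyEq (Eventually.of_forall fun s => by simp)).congr_deriv ?_
    rw [hs]; field_simp; ring
  have := (hasJet_normSq x y ξ).comp h1 h2
  simp only [Real.sqrt_sq (norm_nonneg _)] at this
  refine this.congr_val (by field_simp) ?_
  field_simp
  ring

end JetsInner

section Partials

variable {d : ℕ}

/-- The partial derivative in the `i`-th coordinate direction. -/
def pd (i : Fin d) (f : EuclideanSpace ℝ (Fin d) → ℝ) : EuclideanSpace ℝ (Fin d) → ℝ :=
  fun z => fderiv ℝ f z (EuclideanSpace.single i 1)

lemma fderiv_apply_eq_sum (f : EuclideanSpace ℝ (Fin d) → ℝ) (y ξ : EuclideanSpace ℝ (Fin d)) :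
    fderiv ℝ f y ξ = ∑ i, ξ i * pd i f y := by
  have : ξ = ∑ i, ξ i • EuclideanSpace.single i (1 : ℝ) := by
    simpa using ((EuclideanSpace.basisFun (Fin d) ℝ).sum_repr ξ).symm
  conv_lhs => rw [this]
  simp [pd]

lemma abs_pd_le (f : EuclideanSpace ℝ (Fin d) → ℝ) (y : EuclideanSpace ℝ (Fin d)) (i : Fin d) :
    |pd i f y| ≤ ‖fderiv ℝ f y‖ := by
  simpa [pd] using (fderiv ℝ f y).le_opNorm (EuclideanSpace.single i 1)

lemma contDiffOn_pd {f : EuclideanSpace ℝ (Fin d) → ℝ} {W : Set (EuclideanSpace ℝ (Fin d))}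
    (hW : IsOpen W) (hf : ContDiffOn ℝ (⊤ : ℕ∞) f W) (i : Fin d) :
    ContDiffOn ℝ (⊤ : ℕ∞) (pd i f) W :=
  (hf.fderiv_of_isOpen hW (by simp)).clm_apply contDiffOn_const

lemma pd_comm {f : EuclideanSpace ℝ (Fin d) → ℝ} {y : EuclideanSpace ℝ (Fin d)}
    (hf : ContDiffAt ℝ 2 f y) (i j : Fin d) : pd i (pd j f) y = pd j (pd i f) y := by
  have h1 : DifferentiableAt ℝ (fderiv ℝ f) y :=
    (hf.fderiv_right (m := 1) (by norm_num)).differentiableAt (by simp)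
  have key : ∀ i j : Fin d, pd i (pd j f) y =
      fderiv ℝ (fderiv ℝ f) y (EuclideanSpace.single i 1) (EuclideanSpace.single j 1) := by
    intro i j
    change fderiv ℝ (fun z => fderiv ℝ f z (EuclideanSpace.single j 1)) y _ = _
    rw [fderiv_clm_apply h1 (differentiableAt_const _)]
    simp
  rw [key, key]
  exact hf.isSymmSndFDerivAt (by simp) _ _

lemma contDiffAt_two {f : EuclideanSpace ℝ (Fin d) → ℝ} {W : Set (EuclideanSpace ℝ (Fin d))}
    (hW : IsOpen W) (hf : ContDiffOn ℝ (⊤ : ℕ∞) f W) {y : EuclideanSpace ℝ (Fin d)}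
    (hy : y ∈ W) : ContDiffAt ℝ 2 f y :=
  (hf.contDiffAt (hW.mem_nhds hy)).of_le (WithTop.coe_le_coe.2 (le_top : (2 : ℕ∞) ≤ ⊤))

lemma pd_pd_pd {f : EuclideanSpace ℝ (Fin d) → ℝ} {W : Set (EuclideanSpace ℝ (Fin d))}
    (hW : IsOpen W) (hf : ContDiffOn ℝ (⊤ : ℕ∞) f W) {y : EuclideanSpace ℝ (Fin d)}
    (hy : y ∈ W) (i j k : Fin d) : pd k (pd j (pd i f)) y = pd j (pd i (pd k f)) y := by
  rw [pd_comm (contDiffAt_two hW (contDiffOn_pd hW hf i) hy)]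
  have : pd k (pd i f) =ᶠ[𝓝 y] pd i (pd k f) := by
    filter_upwards [hW.mem_nhds hy] with z hz
    exact pd_comm (contDiffAt_two hW hf hz) k i
  unfold pd at this ⊢
  rw [this.fderiv_eq]

lemma hasDerivAt_pd {f : EuclideanSpace ℝ (Fin d) → ℝ} {y : EuclideanSpace ℝ (Fin d)}
    (hf : ContDiffAt ℝ 2 f y) (k : Fin d) :
    HasDerivAt (fun t : ℝ => f (y + t • EuclideanSpace.single k (1 : ℝ))) (pd k f y) 0 :=
  (hasJet_of_contDiffAt hf _).hasDerivAt

end Partials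

section Frame

variable {d : ℕ}

/-- First coefficient of the frame vector `tau`. -/
def al (l : Fin d) (p : Fin d → ℝ) (i : Fin d) : ℝ := if i = l then 0 else 1 + p l

/-- Second coefficient of the frame vector `tau`. -/
def be (l : Fin d) (p : Fin d → ℝ) (i : Fin d) : ℝ := if i = l then 1 else p i

/-- Vectors with `∑ i, τ i ⊗ τ i = (1 + p_d) ^ 2 • A(p)`. -/
def tau (l : Fin d) (p : Fin d → ℝ) (i : Fin d) : EuclideanSpace ℝ (Fin d) :=
  al l p i • EuclideanSpace.single i 1 + be l p i • EuclideanSpace.single l 1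

/-- The quadratic form of `(1 + p_d) ^ 2 • A(p)`. -/
def qf (l : Fin d) (p z : Fin d → ℝ) : ℝ := ∑ i, (al l p i * z i + be l p i * z l) ^ 2

/-- The contraction of `(1 + p_d) ^ 2 • A(p)` with a symmetric matrix. -/
def opL (l : Fin d) (p : Fin d → ℝ) (h : Fin d → Fin d → ℝ) : ℝ :=
  ∑ i, (al l p i ^ 2 * h i i + 2 * al l p i * be l p i * h i l + be l p i ^ 2 * h l l)

lemma hasJet_tau {f : EuclideanSpace ℝ (Fin d) → ℝ} {y : EuclideanSpace ℝ (Fin d)}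
    (hf : ContDiffAt ℝ 2 f y) (l : Fin d) (p : Fin d → ℝ) (i : Fin d) :
    HasJet f y (tau l p i) (al l p i * pd i f y + be l p i * pd l f y)
      (al l p i ^ 2 * pd i (pd i f) y + 2 * al l p i * be l p i * pd l (pd i f) y
        + be l p i ^ 2 * pd l (pd l f) y) := by
  have h1 : DifferentiableAt ℝ (fderiv ℝ f) y :=
    (hf.fderiv_right (m := 1) (by norm_num)).differentiableAt (by simp)
  have h2 : ∀ j, DifferentiableAt ℝ (pd j f) y := fun j =>
    h1.clm_apply (differentiableAt_const _)
  refine (hasJet_of_contDiffAt hf (tau l p i)).congr_val ?_ ?_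
  · simp [tau, pd]
  · have e : (fun z => fderiv ℝ f z (tau l p i)) =
        fun z => al l p i * pd i f z + be l p i * pd l f z := by
      funext z; simp [tau, pd]
    rw [e, fderiv_fun_add ((h2 i).const_mul _) ((h2 l).const_mul _), fderiv_const_mul (h2 i),
      fderiv_const_mul (h2 l)]
    have e2 := pd_comm hf i l
    simp only [tau, map_add, map_smul, add_apply,
      smul_apply, smul_eq_mul]
    change al l p i * (al l p i * pd i (pd i f) y + be l p i * pd i (pd l f) y)
      + be l p i * (al l p i * pd l (pd i f) y + be l p i * pd l (pd l f) y) = _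
    rw [e2]; ring

lemma hodA_contract (hd : 0 < d) (p : Fin d → ℝ) (h : Fin d → Fin d → ℝ)
    (hs : ∀ i j, h i j = h j i) (hp : 1 + p (lastIdx d hd) ≠ 0) :
    (1 + p (lastIdx d hd)) ^ 2 * ∑ i, ∑ j, hodA d hd p i j * h i j =
      opL (lastIdx d hd) p h := by
  set l := lastIdx d hd with hl
  have e1 : tangSq d hd p = ∑ i ∈ Finset.univ.erase l, p i ^ 2 := by
    rw [tangSq, ← Finset.add_sum_erase _ _ (Finset.mem_univ l)]
    simp only [← hl, if_true, zero_add]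
    exact Finset.sum_congr rfl fun i hi => if_neg (Finset.ne_of_mem_erase hi)
  have e2 : ∀ i ∈ Finset.univ.erase l, ∑ j, hodA d hd p i j * h i j =
      p i / (1 + p l) * h i l + h i i := by
    intro i hi
    have hi' := Finset.ne_of_mem_erase hi
    rw [← Finset.add_sum_erase _ _ (Finset.mem_univ l)]
    congr 1
    · simp [hodA, ← hl, hi']
    · rw [Finset.sum_eq_single_of_mem i hi]
      · simp [hodA, ← hl, hi']
      · intro j hj hji
        simp [hodA, ← hl, hi', Finset.ne_of_mem_erase hj, hji.symm]
  have e3 : ∑ j, hodA d hd p l j * h l j = (1 + tangSq d hd p) / (1 + p l) ^ 2 * h l l +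
      ∑ i ∈ Finset.univ.erase l, p i / (1 + p l) * h i l := by
    rw [← Finset.add_sum_erase _ _ (Finset.mem_univ l)]
    congr 1
    · simp [hodA, ← hl]
    · refine Finset.sum_congr rfl fun i hi => ?_
      simp [hodA, ← hl, Finset.ne_of_mem_erase hi, hs l i]
  rw [opL, ← Finset.add_sum_erase _ (fun i => ∑ j, hodA d hd p i j * h i j) (Finset.mem_univ l),
    ← Finset.add_sum_erase _ (fun i => al l p i ^ 2 * h i i + _ + _) (Finset.mem_univ l),
    e3, Finset.sum_congr rfl e2, e1]
  have e4 : ∑ i ∈ Finset.univ.erase l, (al l p i ^ 2 * h i i + 2 * al l p i * be l p i * h i l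
      + be l p i ^ 2 * h l l) = ∑ i ∈ Finset.univ.erase l, ((1 + p l) ^ 2 * h i i
      + 2 * (1 + p l) * p i * h i l + p i ^ 2 * h l l) := by
    refine Finset.sum_congr rfl fun i hi => ?_
    simp [al, be, Finset.ne_of_mem_erase hi]
  rw [e4]
  simp only [Finset.sum_add_distrib, mul_add, ← Finset.sum_mul, Finset.mul_sum]
  have e5 : ∀ i, (1 + p l) ^ 2 * (p i / (1 + p l) * h i l) = (1 + p l) * p i * h i l := by
    intro i; field_simp
  simp only [e5, al, be, if_true, add_div]
  have e6 : ∑ i ∈ Finset.univ.erase l, (2 * 1 + 2 * p l) * p i * h i l =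
      ∑ i ∈ Finset.univ.erase l, (1 + p l) * p i * h i l +
      ∑ i ∈ Finset.univ.erase l, (1 + p l) * p i * h i l := by
    rw [← Finset.sum_add_distrib]
    exact Finset.sum_congr rfl fun i _ => by ring
  rw [e6]
  field_simp
  ring

/-- Differentiating the equation in the `k`-th direction. -/
lemma opL_pd {v : EuclideanSpace ℝ (Fin d) → ℝ} {W : Set (EuclideanSpace ℝ (Fin d))}
    (hW : IsOpen W) (hv : ContDiffOn ℝ (⊤ : ℕ∞) v W) {y : EuclideanSpace ℝ (Fin d)}
    (hy : y ∈ W) (l k : Fin d)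
    (h0 : ∀ᶠ z in 𝓝 y, opL l (fun i => pd i v z) (fun i j => pd j (pd i v) z) = 0) :
    opL l (fun i => pd i v y) (fun i j => pd j (pd i (pd k v)) y) =
      -∑ i, if i = l then 0 else
        2 * (1 + pd l v y) * pd k (pd l v) y * pd i (pd i v) y
        + 2 * pd k (pd l v) y * pd i v y * pd l (pd i v) y
        + 2 * (1 + pd l v y) * pd k (pd i v) y * pd l (pd i v) y
        + 2 * pd i v y * pd k (pd i v) y * pd l (pd l v) y := by
  have s1 : ∀ i, ContDiffOn ℝ (⊤ : ℕ∞) (pd i v) W := contDiffOn_pd hW hv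
  have s2 : ∀ i j, ContDiffOn ℝ (⊤ : ℕ∞) (pd j (pd i v)) W := fun i j => contDiffOn_pd hW (s1 i) j
  have D1 : ∀ i, HasDerivAt (fun t : ℝ => pd i v (y + t • EuclideanSpace.single k (1 : ℝ)))
      (pd k (pd i v) y) 0 := fun i => hasDerivAt_pd (contDiffAt_two hW (s1 i) hy) k
  have D2 : ∀ i j, HasDerivAt
      (fun t : ℝ => pd j (pd i v) (y + t • EuclideanSpace.single k (1 : ℝ)))
      (pd j (pd i (pd k v)) y) 0 := fun i j => by
    rw [← pd_pd_pd hW hv hy]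
    exact hasDerivAt_pd (contDiffAt_two hW (s2 i j) hy) k
  set γ : ℝ → EuclideanSpace ℝ (Fin d) := fun t => y + t • EuclideanSpace.single k (1 : ℝ)
  have γ0 : γ 0 = y := by simp [γ]
  have hterm : ∀ i, HasDerivAt (fun t : ℝ =>
      al l (fun i => pd i v (γ t)) i ^ 2 * pd i (pd i v) (γ t)
      + 2 * al l (fun i => pd i v (γ t)) i * be l (fun i => pd i v (γ t)) i * pd l (pd i v) (γ t)
      + be l (fun i => pd i v (γ t)) i ^ 2 * pd l (pd l v) (γ t))
      ((al l (fun i => pd i v y) i ^ 2 * pd i (pd i (pd k v)) y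
      + 2 * al l (fun i => pd i v y) i * be l (fun i => pd i v y) i * pd l (pd i (pd k v)) y
      + be l (fun i => pd i v y) i ^ 2 * pd l (pd l (pd k v)) y) +
      (if i = l then 0 else
        2 * (1 + pd l v y) * pd k (pd l v) y * pd i (pd i v) y
        + 2 * pd k (pd l v) y * pd i v y * pd l (pd i v) y
        + 2 * (1 + pd l v y) * pd k (pd i v) y * pd l (pd i v) y
        + 2 * pd i v y * pd k (pd i v) y * pd l (pd l v) y)) 0 := by
    intro i
    by_cases hi : i = l
    · simp only [al, be, hi, if_true]
      simpa using D2 l l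
    · simp only [al, be, hi, if_false]
      have a := ((D1 l).const_add 1)
      refine ((((a.pow 2).mul (D2 i i)).add (((a.const_mul 2).mul (D1 i)).mul (D2 i l))).add
        (((D1 i).pow 2).mul (D2 l l))).congr_deriv ?_
      simp only [zero_smul, add_zero, Pi.pow_apply, Pi.mul_apply]
      ring
  have hsum := HasDerivAt.fun_sum (u := Finset.univ) fun i _ => hterm i
  have hz : (fun t : ℝ => ∑ i, (al l (fun i => pd i v (γ t)) i ^ 2 * pd i (pd i v) (γ t)
      + 2 * al l (fun i => pd i v (γ t)) i * be l (fun i => pd i v (γ t)) i * pd l (pd i v) (γ t)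
      + be l (fun i => pd i v (γ t)) i ^ 2 * pd l (pd l v) (γ t))) =ᶠ[𝓝 0] fun _ => (0 : ℝ) := by
    have hc : Tendsto γ (𝓝 0) (𝓝 y) := by
      have : Continuous γ := by fun_prop
      simpa [γ0] using this.tendsto 0
    exact hc.eventually h0
  have := hsum.unique ((hasDerivAt_const (0 : ℝ) (0 : ℝ)).congr_of_eventuallyEq hz)
  rw [Finset.sum_add_distrib] at this
  rw [opL]
  linarith

end Frame

section Algebra

variable {d : ℕ}

/-- The smallness threshold for the gradient. -/
def eta (d : ℕ) : ℝ := 1 / (10 ^ 4 * (d : ℝ) ^ 3)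

lemma eta_pos (hd : 3 ≤ d) : 0 < eta d := by
  have : (0 : ℝ) < d := by positivity
  unfold eta; positivity

lemma cube_mul_eta (hd : 3 ≤ d) : (d : ℝ) ^ 3 * eta d = 1 / 10 ^ 4 := by
  have : (0 : ℝ) < d := by positivity
  unfold eta; field_simp

lemma mul_eta_le (hd : 3 ≤ d) : (d : ℝ) * eta d ≤ 1 / 90000 := by
  have h3 : (3 : ℝ) ≤ d := by exact_mod_cast hd
  have h := cube_mul_eta hd
  have := eta_pos hd
  have : 9 * ((d : ℝ) * eta d) ≤ (d : ℝ) ^ 3 * eta d := by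
    have : (9 : ℝ) ≤ (d : ℝ) ^ 2 := by nlinarith
    have h0 : 0 ≤ (d : ℝ) * eta d := by positivity
    nlinarith
  linarith

lemma eta_le (hd : 3 ≤ d) : eta d ≤ 1 / 270000 := by
  have h3 : (3 : ℝ) ≤ d := by exact_mod_cast hd
  have h := mul_eta_le hd
  have := eta_pos hd
  nlinarith

lemma abs_qf_sub_le (hd : 3 ≤ d) {p : Fin d → ℝ} (hp : ∀ i, |p i| ≤ eta d) (l : Fin d)
    (z : Fin d → ℝ) : |qf l p z - ∑ i, z i ^ 2| ≤ (∑ i, z i ^ 2) / 100 := by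
  set S := ∑ i, z i ^ 2 with hS
  have hS0 : 0 ≤ S := Finset.sum_nonneg fun i _ => sq_nonneg _
  have hz : ∀ i, z i ^ 2 ≤ S := fun i =>
    Finset.single_le_sum (f := fun i => z i ^ 2) (fun i _ => sq_nonneg _) (Finset.mem_univ i)
  have he0 := eta_pos hd
  have he1 := eta_le hd
  have he2 := mul_eta_le hd
  rw [qf, ← Finset.sum_sub_distrib]
  refine (Finset.abs_sum_le_sum_abs _ _).trans ?_
  have : ∀ i ∈ Finset.univ, |(al l p i * z i + be l p i * z l) ^ 2 - z i ^ 2| ≤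
      10 * eta d * S := by
    intro i _
    by_cases hi : i = l
    · subst hi; simp [al, be]; positivity
    · simp only [al, be, hi, if_false]
      have h1 := abs_le.1 (hp l)
      have h2 := abs_le.1 (hp i)
      have hzz : |z i * z l| ≤ S := by
        rw [abs_le]; constructor <;> nlinarith [hz i, hz l, sq_nonneg (z i + z l), sq_nonneg (z i - z l)]
      have e : ((1 + p l) * z i + p i * z l) ^ 2 - z i ^ 2 =
          (2 * p l + p l ^ 2) * z i ^ 2 + 2 * (1 + p l) * p i * (z i * z l) + p i ^ 2 * z l ^ 2 := by
        ring
      have b1 : |2 * p l + p l ^ 2| ≤ 3 * eta d := by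
        rw [abs_le]; constructor <;> nlinarith
      have b2 : |2 * (1 + p l) * p i| ≤ 3 * eta d := by
        rw [abs_mul]
        have : |2 * (1 + p l)| ≤ 3 := by rw [abs_le]; constructor <;> linarith
        exact mul_le_mul this (hp i) (abs_nonneg _) (by norm_num)
      have b3 : |p i ^ 2| ≤ eta d := by
        rw [abs_le]; constructor <;> nlinarith
      rw [e]
      refine (abs_add_three _ _ _).trans ?_
      rw [abs_mul, abs_mul (2 * (1 + p l) * p i), abs_mul (p i ^ 2), abs_of_nonneg (sq_nonneg (z i)),
        abs_of_nonneg (sq_nonneg (z l))]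
      have c1 := mul_le_mul b1 (hz i) (sq_nonneg _) (by positivity)
      have c2 := mul_le_mul b2 hzz (abs_nonneg _) (by positivity)
      have c3 := mul_le_mul b3 (hz l) (sq_nonneg _) (by positivity)
      nlinarith [mul_nonneg he0.le hS0]
  refine (Finset.sum_le_sum this).trans ?_
  simp only [Finset.sum_const, Finset.card_univ, Fintype.card_fin, nsmul_eq_mul]
  nlinarith

lemma qf_le (hd : 3 ≤ d) {p : Fin d → ℝ} (hp : ∀ i, |p i| ≤ eta d) (l : Fin d)
    (z : Fin d → ℝ) : qf l p z ≤ 101 / 100 * ∑ i, z i ^ 2 := by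
  have := abs_le.1 (abs_qf_sub_le hd hp l z); linarith

lemma le_qf (hd : 3 ≤ d) {p : Fin d → ℝ} (hp : ∀ i, |p i| ≤ eta d) (l : Fin d)
    (z : Fin d → ℝ) : 99 / 100 * ∑ i, z i ^ 2 ≤ qf l p z := by
  have := abs_le.1 (abs_qf_sub_le hd hp l z); linarith

lemma abs_frame_sub_le (hd : 3 ≤ d) {p : Fin d → ℝ} (hp : ∀ i, |p i| ≤ eta d) (l : Fin d) :
    |∑ i, (al l p i ^ 2 + be l p i ^ 2) - d| ≤ 1 / 100 := by
  have he0 := eta_pos hd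
  have he1 := eta_le hd
  have he2 := mul_eta_le hd
  have : ∑ i, (al l p i ^ 2 + be l p i ^ 2) - d = ∑ i, (al l p i ^ 2 + be l p i ^ 2 - 1) := by
    simp [Finset.sum_sub_distrib]
  rw [this]
  refine (Finset.abs_sum_le_sum_abs _ _).trans ?_
  have : ∀ i ∈ Finset.univ, |al l p i ^ 2 + be l p i ^ 2 - 1| ≤ 4 * eta d := by
    intro i _
    by_cases hi : i = l
    · simp [al, be, hi]; positivity
    · simp only [al, be, hi, if_false]
      have h1 := abs_le.1 (hp l)
      have h2 := abs_le.1 (hp i)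
      rw [abs_le]; constructor <;> nlinarith
  refine (Finset.sum_le_sum this).trans ?_
  simp only [Finset.sum_const, Finset.card_univ, Fintype.card_fin, nsmul_eq_mul]
  nlinarith

/-- Indicator of the tangential indices. -/
def tg (l : Fin d) (i : Fin d) : ℝ := if i = l then 0 else 1

lemma tg_nonneg (l i : Fin d) : 0 ≤ tg l i := by unfold tg; split_ifs <;> norm_num

lemma tg_le_one (l i : Fin d) : tg l i ≤ 1 := by unfold tg; split_ifs <;> norm_num

lemma sum_eq_tg (l : Fin d) (f : Fin d → ℝ) : ∑ i, f i = f l + ∑ i, tg l i * f i := by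
  rw [← Finset.add_sum_erase _ _ (Finset.mem_univ l)]
  congr 1
  rw [← Finset.add_sum_erase _ (fun i => tg l i * f i) (Finset.mem_univ l)]
  simp only [tg, if_true, zero_mul, zero_add]
  exact Finset.sum_congr rfl fun i hi => by simp [Finset.ne_of_mem_erase hi]

/-- The equation controls the full Hessian by its tangential rows. -/
lemma hess_le_tangential (hd : 3 ≤ d) {p : Fin d → ℝ} (hp : ∀ i, |p i| ≤ eta d) (l : Fin d)
    {h : Fin d → Fin d → ℝ} (hs : ∀ i j, h i j = h j i) (h0 : opL l p h = 0) :
    ∑ i, ∑ j, h i j ^ 2 ≤ 7 * d * ∑ i, tg l i * ∑ j, h i j ^ 2 := by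
  have h3 : (3 : ℝ) ≤ d := by exact_mod_cast hd
  have he0 := eta_pos hd
  have he1 := eta_le hd
  set G := ∑ i, tg l i * ∑ j, h i j ^ 2 with hG
  have hrow : ∀ i, 0 ≤ ∑ j, h i j ^ 2 := fun i => Finset.sum_nonneg fun j _ => sq_nonneg _
  have hG0 : 0 ≤ G := Finset.sum_nonneg fun i _ => mul_nonneg (tg_nonneg l i) (hrow i)
  have hll : h l l ^ 2 ≤ 5 * d * G := by
    have e : (1 + ∑ i, tg l i * p i ^ 2) * h l l =
        -∑ i, tg l i * ((1 + p l) ^ 2 * h i i + 2 * (1 + p l) * p i * h i l) := by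
      rw [opL, sum_eq_tg l] at h0
      have e1 : ∑ i, tg l i * (al l p i ^ 2 * h i i + 2 * al l p i * be l p i * h i l
          + be l p i ^ 2 * h l l) = ∑ i, tg l i * ((1 + p l) ^ 2 * h i i
          + 2 * (1 + p l) * p i * h i l) + (∑ i, tg l i * p i ^ 2) * h l l := by
        rw [Finset.sum_mul, ← Finset.sum_add_distrib]
        refine Finset.sum_congr rfl fun i _ => ?_
        by_cases hi : i = l
        · simp [tg, hi]
        · simp only [tg, al, be, hi, if_false]; ring
      rw [e1] at h0
      simp only [al, be, if_true] at h0
      linarith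
    have hq : 0 ≤ ∑ i, tg l i * p i ^ 2 :=
      Finset.sum_nonneg fun i _ => mul_nonneg (tg_nonneg l i) (sq_nonneg _)
    have c1 : h l l ^ 2 ≤ ((1 + ∑ i, tg l i * p i ^ 2) * h l l) ^ 2 := by
      rw [mul_pow]
      have : 1 ≤ (1 + ∑ i, tg l i * p i ^ 2) ^ 2 := by nlinarith
      nlinarith [sq_nonneg (h l l)]
    rw [e, neg_sq] at c1
    refine c1.trans ((sq_sum_le_card_mul_sum_sq (s := Finset.univ)).trans ?_)
    simp only [Finset.card_univ, Fintype.card_fin]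
    rw [mul_assoc, mul_left_comm]
    have hd0 : (0 : ℝ) ≤ d := by positivity
    refine mul_le_mul_of_nonneg_left ?_ hd0
    rw [hG, Finset.mul_sum]
    refine Finset.sum_le_sum fun i _ => ?_
    by_cases hi : i = l
    · simp [tg, hi]
    · simp only [tg, hi, if_false, one_mul]
      have h1 := abs_le.1 (hp l)
      have h2 := abs_le.1 (hp i)
      have r : h i i ^ 2 + h i l ^ 2 ≤ ∑ j, h i j ^ 2 := by
        rw [← Finset.sum_pair hi (f := fun j => h i j ^ 2)]
        exact Finset.sum_le_sum_of_subset_of_nonneg (Finset.subset_univ _) fun j _ _ => sq_nonneg _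
      have a1 : ((1 + p l) ^ 2) ^ 2 ≤ 2 := by
        have : (1 + p l) ^ 2 ≤ 5 / 4 := by nlinarith
        nlinarith [sq_nonneg (1 + p l)]
      have a2 : (2 * (1 + p l) * p i) ^ 2 ≤ 2 := by
        have : |2 * (1 + p l) * p i| ≤ 1 := by
          rw [abs_mul]
          have : |2 * (1 + p l)| ≤ 3 := by rw [abs_le]; constructor <;> linarith
          calc _ ≤ 3 * eta d := mul_le_mul this (hp i) (abs_nonneg _) (by norm_num)
            _ ≤ 1 := by linarith
        nlinarith [abs_le.1 this, sq_abs (2 * (1 + p l) * p i), abs_nonneg (2 * (1 + p l) * p i)]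
      calc ((1 + p l) ^ 2 * h i i + 2 * (1 + p l) * p i * h i l) ^ 2
          ≤ 2 * ((1 + p l) ^ 2 * h i i) ^ 2 + 2 * (2 * (1 + p l) * p i * h i l) ^ 2 := by
            nlinarith [sq_nonneg ((1 + p l) ^ 2 * h i i - 2 * (1 + p l) * p i * h i l)]
        _ ≤ 4 * h i i ^ 2 + 4 * h i l ^ 2 := by
            rw [mul_pow, mul_pow (2 * (1 + p l) * p i)]
            nlinarith [sq_nonneg (h i i), sq_nonneg (h i l)]
        _ ≤ 5 * ∑ j, h i j ^ 2 := by nlinarith [sq_nonneg (h i i), sq_nonneg (h i l)]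
  have hl : ∑ j, h l j ^ 2 ≤ h l l ^ 2 + G := by
    rw [sum_eq_tg l]
    refine add_le_add le_rfl (Finset.sum_le_sum fun i _ => ?_)
    refine mul_le_mul_of_nonneg_left ?_ (tg_nonneg l i)
    rw [hs l i]
    exact Finset.single_le_sum (f := fun j => h i j ^ 2) (fun j _ => sq_nonneg _)
      (Finset.mem_univ l)
  rw [sum_eq_tg l]
  nlinarith

/-- The commutator term in the differentiated equation is quadratic in the Hessian. -/
lemma abs_commutator_le (hd : 3 ≤ d) {p : Fin d → ℝ} (hp : ∀ i, |p i| ≤ eta d) (l k : Fin d)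
    (h : Fin d → Fin d → ℝ) :
    |-∑ i, if i = l then (0 : ℝ) else
        2 * (1 + p l) * h l k * h i i + 2 * h l k * p i * h i l
        + 2 * (1 + p l) * h i k * h i l + 2 * p i * h i k * h l l| ≤
      8 * d * ∑ i, ∑ j, h i j ^ 2 := by
  have he0 := eta_pos hd
  have he1 := eta_le hd
  set H := ∑ i, ∑ j, h i j ^ 2 with hH
  have hij : ∀ i j, h i j ^ 2 ≤ H := fun i j =>
    (Finset.single_le_sum (f := fun j => h i j ^ 2) (fun j _ => sq_nonneg _)
      (Finset.mem_univ j)).trans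
    (Finset.single_le_sum (f := fun i => ∑ j, h i j ^ 2)
      (fun i _ => Finset.sum_nonneg fun j _ => sq_nonneg _) (Finset.mem_univ i))
  have hH0 : 0 ≤ H := (sq_nonneg _).trans (hij l l)
  have hpr : ∀ i j i' j', |h i j * h i' j'| ≤ H := fun i j i' j' => by
    rw [abs_le]
    constructor <;> nlinarith [hij i j, hij i' j', sq_nonneg (h i j - h i' j'),
      sq_nonneg (h i j + h i' j')]
  rw [abs_neg]
  refine (Finset.abs_sum_le_sum_abs _ _).trans ?_
  have : ∀ i ∈ Finset.univ, |if i = l then (0 : ℝ) else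
        2 * (1 + p l) * h l k * h i i + 2 * h l k * p i * h i l
        + 2 * (1 + p l) * h i k * h i l + 2 * p i * h i k * h l l| ≤ 8 * H := by
    intro i _
    split_ifs with hi
    · simp; exact hH0
    have h1 := abs_le.1 (hp l)
    have h2 := abs_le.1 (hp i)
    have b1 : |2 * (1 + p l)| ≤ 3 := by rw [abs_le]; constructor <;> linarith
    have b2 : |2 * p i| ≤ 1 := by rw [abs_le]; constructor <;> linarith
    have c1 := mul_le_mul b1 (hpr l k i i) (abs_nonneg _) (by norm_num)
    have c2 := mul_le_mul b2 (hpr l k i l) (abs_nonneg _) (by norm_num)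
    have c3 := mul_le_mul b1 (hpr i k i l) (abs_nonneg _) (by norm_num)
    have c4 := mul_le_mul b2 (hpr i k l l) (abs_nonneg _) (by norm_num)
    rw [← abs_mul] at c1 c2 c3 c4
    rw [abs_le] at c1 c2 c3 c4 ⊢
    constructor <;> nlinarith
  refine (Finset.sum_le_sum this).trans (le_of_eq ?_)
  simp only [Finset.sum_const, Finset.card_univ, Fintype.card_fin, nsmul_eq_mul]
  ring

end Algebra

section Bernstein

variable {d : ℕ}

/-- The tangential part of the squared gradient. -/
def tq (l : Fin d) (p : Fin d → ℝ) : ℝ := ∑ i, tg l i * p i ^ 2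

/-- The defect of the boundary condition `p_d = N(p')`. -/
def bw (l : Fin d) (p : Fin d → ℝ) : ℝ := 2 * p l + p l ^ 2 - tq l p

/-- The Bernstein quantity. -/
def bp (l : Fin d) (p : Fin d → ℝ) : ℝ := tq l p + bw l p ^ 2

lemma tq_nonneg (l : Fin d) (p : Fin d → ℝ) : 0 ≤ tq l p :=
  Finset.sum_nonneg fun i _ => mul_nonneg (tg_nonneg l i) (sq_nonneg _)

lemma bp_nonneg (l : Fin d) (p : Fin d → ℝ) : 0 ≤ bp l p :=
  add_nonneg (tq_nonneg l p) (sq_nonneg _)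

lemma sum_sq_eq (l : Fin d) (p : Fin d → ℝ) : ∑ i, p i ^ 2 = p l ^ 2 + tq l p :=
  sum_eq_tg l fun i => p i ^ 2

lemma tq_le (hd : 3 ≤ d) {p : Fin d → ℝ} (hp : ∀ i, |p i| ≤ eta d) (l : Fin d) :
    tq l p ≤ eta d := by
  have he0 := eta_pos hd
  have he1 := eta_le hd
  have he2 := mul_eta_le hd
  have : ∀ i ∈ Finset.univ, tg l i * p i ^ 2 ≤ eta d ^ 2 := fun i _ => by
    have h2 : p i ^ 2 ≤ eta d ^ 2 := by
      rw [← sq_abs]; exact pow_le_pow_left₀ (abs_nonneg _) (hp i) 2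
    nlinarith [tg_le_one l i, tg_nonneg l i, sq_nonneg (p i)]
  refine (Finset.sum_le_sum this).trans ?_
  simp only [Finset.sum_const, Finset.card_univ, Fintype.card_fin, nsmul_eq_mul]
  nlinarith

lemma abs_bw_le (hd : 3 ≤ d) {p : Fin d → ℝ} (hp : ∀ i, |p i| ≤ eta d) (l : Fin d) :
    |bw l p| ≤ 4 * eta d := by
  have he0 := eta_pos hd
  have he1 := eta_le hd
  have h1 := abs_le.1 (hp l)
  have h2 := tq_le hd hp l
  have h3 := tq_nonneg l p
  rw [bw, abs_le]
  constructor <;> nlinarith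

lemma sum_sq_le_bp (hd : 3 ≤ d) {p : Fin d → ℝ} (hp : ∀ i, |p i| ≤ eta d) (l : Fin d) :
    ∑ i, p i ^ 2 ≤ 2 * bp l p := by
  have he0 := eta_pos hd
  have he1 := eta_le hd
  have h1 := abs_le.1 (hp l)
  have h2 := tq_le hd hp l
  have h3 := tq_nonneg l p
  rw [sum_sq_eq l, bp]
  have e : p l * (2 + p l) = bw l p + tq l p := by rw [bw]; ring
  have e2 : p l ^ 2 * (2 + p l) ^ 2 = (bw l p + tq l p) ^ 2 := by rw [← e]; ring
  have e3 : 3 ≤ (2 + p l) ^ 2 := by nlinarith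
  have e4 : 3 * p l ^ 2 ≤ (bw l p + tq l p) ^ 2 := by nlinarith [sq_nonneg (p l)]
  nlinarith [sq_nonneg (bw l p - tq l p)]

lemma bp_le_sum_sq (hd : 3 ≤ d) {p : Fin d → ℝ} (hp : ∀ i, |p i| ≤ eta d) (l : Fin d) :
    bp l p ≤ 20 * ∑ i, p i ^ 2 := by
  have he0 := eta_pos hd
  have he1 := eta_le hd
  have h1 := abs_le.1 (hp l)
  have h2 := tq_le hd hp l
  have h3 := tq_nonneg l p
  rw [sum_sq_eq l, bp]
  have e : bw l p = p l * (2 + p l) - tq l p := by rw [bw]; ring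
  have e3 : (2 + p l) ^ 2 ≤ 5 := by nlinarith
  have e4 : bw l p ^ 2 ≤ 2 * (p l ^ 2 * (2 + p l) ^ 2) + 2 * tq l p ^ 2 := by
    rw [e]; nlinarith [sq_nonneg (p l * (2 + p l) + tq l p)]
  nlinarith [sq_nonneg (p l)]

set_option maxHeartbeats 1000000 in
/-- The Bernstein inequalities, as pointwise algebra in the derivatives of the solution. -/
lemma bernstein_algebra (hd : 3 ≤ d) {p : Fin d → ℝ} (hp : ∀ i, |p i| ≤ eta d) (l : Fin d)
    {h : Fin d → Fin d → ℝ} (hs : ∀ i j, h i j = h j i) (h0 : opL l p h = 0)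
    {a b : Fin d → Fin d → ℝ} (ha : ∀ i, ∑ m, a m i ^ 2 = qf l p (h i))
    (hb : ∀ i, |∑ m, b m i| ≤ 8 * d * ∑ i, ∑ j, h i j ^ 2) {qa qb wa wb : Fin d → ℝ}
    (hqa : ∀ m, qa m = ∑ i, tg l i * (2 * p i * a m i))
    (hqb : ∀ m, qb m = ∑ i, tg l i * (2 * a m i ^ 2 + 2 * p i * b m i))
    (hwa : ∀ m, wa m = 2 * (1 + p l) * a m l - qa m)
    (hwb : ∀ m, wb m = 2 * a m l ^ 2 + 2 * (1 + p l) * b m l - qb m) :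
    (∑ i, ∑ j, h i j ^ 2) / (7 * d) ≤
        ∑ m, (qb m + 2 * wa m ^ 2 + 2 * bw l p * wb m) ∧
      ∑ m, (qa m + 2 * bw l p * wa m) ^ 2 ≤ 72 * bp l p * ∑ i, ∑ j, h i j ^ 2 := by
  have h3 : (3 : ℝ) ≤ d := by exact_mod_cast hd
  have he0 := eta_pos hd
  have he1 := eta_le hd
  have he3 := cube_mul_eta hd
  have hG := hess_le_tangential hd hp l hs h0
  have hqf1 : ∀ i, qf l p (h i) ≤ 101 / 100 * ∑ j, h i j ^ 2 := fun i => qf_le hd hp l (h i)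
  have hqf2 : ∀ i, 99 / 100 * ∑ j, h i j ^ 2 ≤ qf l p (h i) := fun i => le_qf hd hp l (h i)
  have hrow : ∀ i, 0 ≤ ∑ j, h i j ^ 2 := fun i => Finset.sum_nonneg fun j _ => sq_nonneg _
  set H := ∑ i, ∑ j, h i j ^ 2 with hH
  set G := ∑ i, tg l i * ∑ j, h i j ^ 2 with hGd
  have hH0 : 0 ≤ H := Finset.sum_nonneg fun i _ => hrow i
  have hrowH : ∀ i, ∑ j, h i j ^ 2 ≤ H := fun i =>
    Finset.single_le_sum (f := fun i => ∑ j, h i j ^ 2) (fun i _ => hrow i) (Finset.mem_univ i)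
  have hGH : G ≤ H := Finset.sum_le_sum fun i _ => by
    nlinarith [tg_le_one l i, hrow i]
  have hG0 : 0 ≤ G := Finset.sum_nonneg fun i _ => mul_nonneg (tg_nonneg l i) (hrow i)
  have hpl := abs_le.1 (hp l)
  have hw := abs_bw_le hd hp l
  have hq := tq_le hd hp l
  have hq0 := tq_nonneg l p
  -- the trace of `qb`
  have sqb : ∑ m, qb m = ∑ i, tg l i * (2 * qf l p (h i) + 2 * p i * ∑ m, b m i) := by
    simp_rw [hqb]
    rw [Finset.sum_comm]
    refine Finset.sum_congr rfl fun i _ => ?_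
    rw [← Finset.mul_sum, Finset.sum_add_distrib, ← Finset.mul_sum, ← Finset.mul_sum, ha]
  have herr : ∀ i, |2 * p i * ∑ m, b m i| ≤ 16 * eta d * (d * H) := fun i => by
    rw [abs_mul]
    have : |2 * p i| ≤ 2 * eta d := by
      rw [abs_mul, abs_of_pos (by norm_num : (0 : ℝ) < 2)]; linarith [hp i]
    refine (mul_le_mul this (hb i) (abs_nonneg _) (by positivity)).trans (le_of_eq (by ring))
  have hdH : 0 ≤ eta d * (d * H) := by positivity
  have lqb : 198 / 100 * G - 16 * d * (eta d * (d * H)) ≤ ∑ m, qb m := by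
    have : ∑ i : Fin d, (198 / 100 * (tg l i * ∑ j, h i j ^ 2) - 16 * (eta d * (d * H)))
        ≤ ∑ m, qb m := by
      rw [sqb]
      refine Finset.sum_le_sum fun i _ => ?_
      have t0 := tg_nonneg l i
      have t1 := tg_le_one l i
      have e1 := (abs_le.1 (herr i)).1
      have e2 := mul_le_mul_of_nonneg_left (hqf2 i) t0
      have e3 := mul_le_mul_of_nonneg_left e1 t0
      nlinarith
    refine le_trans (le_of_eq ?_) this
    rw [Finset.sum_sub_distrib, ← Finset.mul_sum, ← hGd]
    simp only [Finset.sum_const, Finset.card_univ, Fintype.card_fin, nsmul_eq_mul]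
    ring
  have uqb : ∑ m, qb m ≤ 202 / 100 * G + 16 * d * (eta d * (d * H)) := by
    have : ∑ m, qb m ≤
        ∑ i : Fin d, (202 / 100 * (tg l i * ∑ j, h i j ^ 2) + 16 * (eta d * (d * H))) := by
      rw [sqb]
      refine Finset.sum_le_sum fun i _ => ?_
      have t0 := tg_nonneg l i
      have t1 := tg_le_one l i
      have e1 := (abs_le.1 (herr i)).2
      have e2 := mul_le_mul_of_nonneg_left (hqf1 i) t0
      have e3 := mul_le_mul_of_nonneg_left e1 t0
      nlinarith
    refine le_trans this (le_of_eq ?_)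
    rw [Finset.sum_add_distrib, ← Finset.mul_sum, ← hGd]
    simp only [Finset.sum_const, Finset.card_univ, Fintype.card_fin, nsmul_eq_mul]
    ring
  have hd2 : 16 * d * (eta d * (d * H)) ≤ H / (100 * d) := by
    rw [le_div_iff₀ (by positivity)]
    have : 16 * d * (eta d * (d * H)) * (100 * d) = 1600 * ((d : ℝ) ^ 3 * eta d) * H := by ring
    rw [this, he3]; nlinarith
  have hHd : H / (100 * d) ≤ H := by
    rw [div_le_iff₀ (by positivity)]; nlinarith
  -- the trace of `wb`
  have swb : ∑ m, wb m = 2 * qf l p (h l) + 2 * (1 + p l) * (∑ m, b m l) - ∑ m, qb m := by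
    simp_rw [hwb]
    rw [Finset.sum_sub_distrib, Finset.sum_add_distrib, ← Finset.mul_sum, ← Finset.mul_sum, ha]
  have bwb : |∑ m, wb m| ≤ 20 * (d * H) := by
    have hdH' : 3 * H ≤ d * H := by nlinarith
    have e1 : |2 * (1 + p l) * ∑ m, b m l| ≤ 17 * (d * H) := by
      rw [abs_mul]
      have : |2 * (1 + p l)| ≤ 17 / 8 := by rw [abs_le]; constructor <;> linarith
      refine (mul_le_mul this (hb l) (abs_nonneg _) (by norm_num)).trans (le_of_eq (by ring))
    have e2 := hqf1 l
    have e3 := hqf2 l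
    have e4 := hrowH l
    have e5 := hrow l
    rw [swb]
    rw [abs_le] at e1 ⊢
    constructor <;> linarith
  have c1 : |2 * bw l p * ∑ m, wb m| ≤ H / (50 * d) := by
    rw [abs_mul]
    have : |2 * bw l p| ≤ 8 * eta d := by
      rw [abs_mul, abs_of_pos (by norm_num : (0 : ℝ) < 2)]; linarith
    refine (mul_le_mul this bwb (abs_nonneg _) (by positivity)).trans ?_
    rw [le_div_iff₀ (by positivity)]
    have e : 8 * eta d * (20 * (d * H)) * (50 * d) = 8000 * ((d : ℝ) ^ 2 * eta d) * H := by ring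
    have e2 : 8000 * ((d : ℝ) ^ 2 * eta d) ≤ 1 := by
      have : 3 * ((d : ℝ) ^ 2 * eta d) ≤ (d : ℝ) ^ 3 * eta d := by
        have : 0 ≤ (d : ℝ) ^ 2 * eta d := by positivity
        nlinarith
      linarith
    rw [e]; nlinarith
  have hGl : H / (7 * d) ≤ G := by
    rw [div_le_iff₀ (by positivity)]; linarith
  -- first-order terms
  have cs : ∀ m, qa m ^ 2 ≤ 4 * tq l p * ∑ i, a m i ^ 2 := fun m => by
    have e : qa m = ∑ i, (2 * tg l i * p i) * a m i := by
      rw [hqa]; exact Finset.sum_congr rfl fun i _ => by ring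
    rw [e]
    refine (Finset.sum_mul_sq_le_sq_mul_sq _ _ _).trans ?_
    refine mul_le_mul_of_nonneg_right ?_ (Finset.sum_nonneg fun i _ => sq_nonneg _)
    rw [tq, Finset.mul_sum]
    refine Finset.sum_le_sum fun i _ => ?_
    unfold tg; split_ifs
    · simp
    · exact le_of_eq (by ring)
  have sa : ∑ m, ∑ i, a m i ^ 2 ≤ 101 / 100 * H := by
    rw [Finset.sum_comm, hH, Finset.mul_sum]
    exact Finset.sum_le_sum fun i _ => by rw [ha]; exact hqf1 i
  have sqa : ∑ m, qa m ^ 2 ≤ 404 / 100 * tq l p * H := by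
    refine (Finset.sum_le_sum fun m _ => cs m).trans ?_
    rw [← Finset.mul_sum]
    refine (mul_le_mul_of_nonneg_left sa (by positivity)).trans (le_of_eq (by ring))
  have swa : ∑ m, wa m ^ 2 ≤ 9 * H := by
    have : ∀ m ∈ Finset.univ, wa m ^ 2 ≤ 81 / 10 * a m l ^ 2 + 2 * qa m ^ 2 := fun m _ => by
      rw [hwa]
      have : (1 + p l) ^ 2 ≤ 81 / 80 := by nlinarith
      have : (2 * (1 + p l) * a m l) ^ 2 ≤ 81 / 20 * a m l ^ 2 := by
        rw [mul_pow]; nlinarith [sq_nonneg (a m l)]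
      nlinarith [sq_nonneg (2 * (1 + p l) * a m l + qa m)]
    refine (Finset.sum_le_sum this).trans ?_
    rw [Finset.sum_add_distrib, ← Finset.mul_sum, ← Finset.mul_sum, ha]
    have e1 := hqf1 l
    have e2 := hrowH l
    have e3 : tq l p * H ≤ 1 / 100 * H := mul_le_mul_of_nonneg_right (by linarith) hH0
    linarith
  constructor
  · rw [Finset.sum_add_distrib, Finset.sum_add_distrib, ← Finset.mul_sum, ← Finset.mul_sum]
    have e1 := (abs_le.1 c1).1
    have e2 : 0 ≤ ∑ m, wa m ^ 2 := Finset.sum_nonneg fun m _ => sq_nonneg _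
    have e3 : H / (100 * d) = 7 / 100 * (H / (7 * d)) := by field_simp
    have e4 : H / (50 * d) = 7 / 50 * (H / (7 * d)) := by field_simp
    linarith
  · have : ∀ m ∈ Finset.univ, (qa m + 2 * bw l p * wa m) ^ 2 ≤
        2 * qa m ^ 2 + 8 * bw l p ^ 2 * wa m ^ 2 := fun m _ => by
      nlinarith [sq_nonneg (qa m - 2 * bw l p * wa m)]
    refine (Finset.sum_le_sum this).trans ?_
    rw [Finset.sum_add_distrib, ← Finset.mul_sum, ← Finset.mul_sum, bp]
    have e1 := mul_le_mul_of_nonneg_left swa (sq_nonneg (bw l p))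
    have e2 := mul_nonneg hq0 hH0
    linarith

/-- The Bernstein quantity of a function. -/
def bpf (l : Fin d) (v : EuclideanSpace ℝ (Fin d) → ℝ) (z : EuclideanSpace ℝ (Fin d)) : ℝ :=
  bp l fun i => pd i v z

lemma bernstein (hd : 3 ≤ d) {v : EuclideanSpace ℝ (Fin d) → ℝ}
    {W : Set (EuclideanSpace ℝ (Fin d))} (hW : IsOpen W) (hv : ContDiffOn ℝ (⊤ : ℕ∞) v W)
    {y : EuclideanSpace ℝ (Fin d)} (hy : y ∈ W) (l : Fin d) (hp : ∀ i, |pd i v y| ≤ eta d)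
    (h0 : ∀ᶠ z in 𝓝 y, opL l (fun i => pd i v z) (fun i j => pd j (pd i v) z) = 0) :
    ∃ (H : ℝ) (a b : Fin d → ℝ), 0 ≤ H ∧
      (∀ m, HasJet (bpf l v) y (tau l (fun i => pd i v y) m) (a m) (b m)) ∧
      H / (7 * d) ≤ ∑ m, b m ∧ ∑ m, a m ^ 2 ≤ 72 * bpf l v y * H := by
  have s1 : ∀ i, ContDiffOn ℝ (⊤ : ℕ∞) (pd i v) W := contDiffOn_pd hW hv
  set p : Fin d → ℝ := fun i => pd i v y with hpd
  set h : Fin d → Fin d → ℝ := fun i j => pd j (pd i v) y with hh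
  have hs : ∀ i j, h i j = h j i := fun i j => pd_comm (contDiffAt_two hW hv hy) j i
  set a : Fin d → Fin d → ℝ := fun m i => al l p m * h i m + be l p m * h i l with had
  set b : Fin d → Fin d → ℝ := fun m i => al l p m ^ 2 * pd m (pd m (pd i v)) y
    + 2 * al l p m * be l p m * pd l (pd m (pd i v)) y
    + be l p m ^ 2 * pd l (pd l (pd i v)) y with hbd
  have hj : ∀ m i, HasJet (pd i v) y (tau l p m) (a m i) (b m i) := fun m i =>
    hasJet_tau (contDiffAt_two hW (s1 i) hy) l p m
  have hb : ∀ i, |∑ m, b m i| ≤ 8 * d * ∑ i, ∑ j, h i j ^ 2 := fun i => by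
    have e := opL_pd hW hv hy l i h0
    have e2 : ∑ m, b m i = opL l (fun i => pd i v y) (fun m j => pd j (pd m (pd i v)) y) := rfl
    rw [e2, e]
    exact abs_commutator_le hd hp l i h
  set qa : Fin d → ℝ := fun m => ∑ i, tg l i * (2 * p i * a m i) with hqa
  set qb : Fin d → ℝ := fun m => ∑ i, tg l i * (2 * a m i ^ 2 + 2 * p i * b m i) with hqb
  set wa : Fin d → ℝ := fun m => 2 * (1 + p l) * a m l - qa m with hwa
  set wb : Fin d → ℝ := fun m => 2 * a m l ^ 2 + 2 * (1 + p l) * b m l - qb m with hwb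
  have key := bernstein_algebra hd hp l hs h0.self_of_nhds (a := a) (b := b) (qa := qa)
    (qb := qb) (wa := wa) (wb := wb) (fun i => rfl) hb (fun _ => rfl) (fun _ => rfl)
    (fun _ => rfl) (fun _ => rfl)
  have jsq : ∀ m i, HasJet (fun z => pd i v z ^ 2) y (tau l p m) (2 * p i * a m i)
      (2 * a m i ^ 2 + 2 * p i * b m i) := fun m i => by
    simp_rw [sq]
    exact ((hj m i).mul (hj m i)).congr_val (by simp only [hpd]; ring) (by simp only [hpd]; ring)
  have jq : ∀ m, HasJet (fun z => tq l fun i => pd i v z) y (tau l p m) (qa m) (qb m) := fun m =>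
    HasJet.sum fun i _ => (jsq m i).const_mul (tg l i)
  have jw : ∀ m, HasJet (fun z => bw l fun i => pd i v z) y (tau l p m) (wa m) (wb m) := fun m => by
    have := (((hj m l).const_mul 2).add (jsq m l)).add ((jq m).const_mul (-1))
    have e : (fun z => bw l fun i => pd i v z) = fun z => 2 * pd l v z + pd l v z ^ 2 +
        -1 * tq l (fun i => pd i v z) := by funext z; rw [bw]; ring
    rw [e]
    exact this.congr_val (by simp only [hwa]; ring) (by simp only [hwb]; ring)
  refine ⟨∑ i, ∑ j, h i j ^ 2, fun m => qa m + 2 * bw l p * wa m,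
    fun m => qb m + 2 * wa m ^ 2 + 2 * bw l p * wb m,
    Finset.sum_nonneg fun i _ => Finset.sum_nonneg fun j _ => sq_nonneg _, fun m => ?_,
    key.1, key.2⟩
  have := (jq m).add ((jw m).mul (jw m))
  have e : bpf l v = fun z => tq l (fun i => pd i v z) +
      bw l (fun i => pd i v z) * bw l (fun i => pd i v z) := by
    funext z; rw [bpf, bp]; ring
  rw [e]
  exact this.congr_val (by ring) (by ring)

end Bernstein

section Gradient

variable {d : ℕ}

/-- A smooth solution of the hodograph problem outside the unit ball, with small gradient. -/
structure RegSol (l : Fin d) (v : EuclideanSpace ℝ (Fin d) → ℝ)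
    (W : Set (EuclideanSpace ℝ (Fin d))) : Prop where
  isOpen : IsOpen W
  mem : ∀ y : EuclideanSpace ℝ (Fin d), 0 ≤ y l → 1 ≤ ‖y‖ → y ∈ W
  smooth : ContDiffOn ℝ (⊤ : ℕ∞) v W
  small : ∀ y : EuclideanSpace ℝ (Fin d), 0 ≤ y l → 1 ≤ ‖y‖ → ‖fderiv ℝ v y‖ ≤ eta d
  eqn : ∀ y : EuclideanSpace ℝ (Fin d), 0 < y l → 1 ≤ ‖y‖ →
    opL l (fun i => pd i v y) (fun i j => pd j (pd i v) y) = 0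
  bdry : ∀ y : EuclideanSpace ℝ (Fin d), y l = 0 → 1 ≤ ‖y‖ → bw l (fun i => pd i v y) = 0

/-- An inward direction at the flat boundary. -/
def bdir (l : Fin d) (c : Fin d → ℝ) : EuclideanSpace ℝ (Fin d) :=
  WithLp.toLp 2 fun i => if i = l then 1 else -c i

lemma sum_bdir (l : Fin d) (c f : Fin d → ℝ) :
    ∑ i, bdir l c i * f i = f l - ∑ i, tg l i * (c i * f i) := by
  rw [sum_eq_tg l, sub_eq_add_neg, ← Finset.sum_neg_distrib]
  congr 1
  · simp [bdir]
  · refine Finset.sum_congr rfl fun i _ => ?_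
    by_cases hi : i = l
    · simp [tg, hi]
    · simp [tg, hi, bdir]

lemma fderiv_bdir (f : EuclideanSpace ℝ (Fin d) → ℝ) (y : EuclideanSpace ℝ (Fin d)) (l : Fin d)
    (c : Fin d → ℝ) :
    fderiv ℝ f y (bdir l c) = pd l f y - ∑ i, tg l i * (c i * pd i f y) := by
  rw [fderiv_apply_eq_sum, sum_bdir]

lemma inner_bdir (z : EuclideanSpace ℝ (Fin d)) (l : Fin d) (c : Fin d → ℝ) :
    inner ℝ z (bdir l c) = z l - ∑ i, tg l i * (c i * z i) := by
  rw [← sum_bdir, PiLp.inner_apply]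
  simp

lemma bdir_last (l : Fin d) (c : Fin d → ℝ) : bdir l c l = 1 := by simp [bdir]

lemma abs_coord_le (z : EuclideanSpace ℝ (Fin d)) (i : Fin d) : |z i| ≤ ‖z‖ := by
  simpa using PiLp.norm_apply_le z i

/-- A small tangential perturbation. -/
lemma abs_tangential_le (hd : 3 ≤ d) (l : Fin d) {c : Fin d → ℝ} (hc : ∀ i, |c i| ≤ 2 * eta d)
    (z : EuclideanSpace ℝ (Fin d)) : |∑ i, tg l i * (c i * z i)| ≤ 1 / 10000 * ‖z‖ := by
  have he0 := eta_pos hd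
  have he2 := mul_eta_le hd
  refine (Finset.abs_sum_le_sum_abs _ _).trans ?_
  have : ∀ i ∈ Finset.univ, |tg l i * (c i * z i)| ≤ 2 * eta d * ‖z‖ := fun i _ => by
    rw [abs_mul, abs_mul, abs_of_nonneg (tg_nonneg l i)]
    have h1 := mul_le_mul (hc i) (abs_coord_le z i) (abs_nonneg _) (by positivity)
    have h2 : 0 ≤ |c i| * |z i| := by positivity
    nlinarith [tg_le_one l i]
  refine (Finset.sum_le_sum this).trans ?_
  simp only [Finset.sum_const, Finset.card_univ, Fintype.card_fin, nsmul_eq_mul]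
  nlinarith [norm_nonneg z]

lemma RegSol.abs_pd_le {l : Fin d} {v : EuclideanSpace ℝ (Fin d) → ℝ}
    {W : Set (EuclideanSpace ℝ (Fin d))} (S : RegSol l v W) {y : EuclideanSpace ℝ (Fin d)}
    (h0 : 0 ≤ y l) (h1 : 1 ≤ ‖y‖) (i : Fin d) : |pd i v y| ≤ eta d :=
  (Hodograph.abs_pd_le v y i).trans (S.small y h0 h1)

/-- On the flat boundary, the Bernstein quantity is stationary in an inward oblique direction. -/
lemma RegSol.boundary_jet (hd : 3 ≤ d) {l : Fin d} {v : EuclideanSpace ℝ (Fin d) → ℝ}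
    {W : Set (EuclideanSpace ℝ (Fin d))} (S : RegSol l v W) {y : EuclideanSpace ℝ (Fin d)}
    (h0 : y l = 0) (h1 : ∀ᶠ z in 𝓝 y, 0 ≤ z l → 1 ≤ ‖z‖) :
    ∃ (c : Fin d → ℝ) (av bv b : ℝ), (∀ i, |c i| ≤ 2 * eta d) ∧ av ≤ 0 ∧
      HasJet v y (bdir l c) av bv ∧ HasJet (bpf l v) y (bdir l c) 0 b := by
  have he0 := eta_pos hd
  have he1 := eta_le hd
  have hy1 : 1 ≤ ‖y‖ := h1.self_of_nhds h0.ge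
  have hy := S.mem y h0.ge hy1
  have hp := S.abs_pd_le h0.ge hy1
  have s1 : ∀ i, ContDiffOn ℝ (⊤ : ℕ∞) (pd i v) W := contDiffOn_pd S.isOpen S.smooth
  have sy : ∀ i, ContDiffAt ℝ 2 (pd i v) y := fun i => contDiffAt_two S.isOpen (s1 i) hy
  have vy := contDiffAt_two S.isOpen S.smooth hy
  set p : Fin d → ℝ := fun i => pd i v y with hpd
  have hw : bw l p = 0 := S.bdry y h0 hy1
  have hpl := abs_le.1 (hp l)
  have hpl1 : 0 < 1 + p l := by simp only [hpd]; linarith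
  -- tangential derivatives of the boundary condition
  have tang : ∀ k, k ≠ l → (1 + p l) * pd k (pd l v) y =
      ∑ i, tg l i * (p i * pd k (pd i v) y) := by
    intro k hk
    have D : ∀ i, HasDerivAt (fun t : ℝ => pd i v (y + t • EuclideanSpace.single k (1 : ℝ)))
        (pd k (pd i v) y) 0 := fun i => hasDerivAt_pd (sy i) k
    have Dq := HasDerivAt.fun_sum (u := Finset.univ) fun i _ => ((D i).pow 2).const_mul (tg l i)
    have Dw := (((D l).const_mul 2).add ((D l).pow 2)).sub Dq
    have hz : (fun t : ℝ => bw l fun i => pd i v (y + t • EuclideanSpace.single k (1 : ℝ)))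
        =ᶠ[𝓝 0] fun _ => (0 : ℝ) := by
      have hc : Tendsto (fun t : ℝ => y + t • EuclideanSpace.single k (1 : ℝ)) (𝓝 0) (𝓝 y) := by
        have : Continuous (fun t : ℝ => y + t • EuclideanSpace.single k (1 : ℝ)) := by fun_prop
        simpa using this.tendsto 0
      filter_upwards [hc.eventually h1] with t ht
      have e : (y + t • EuclideanSpace.single k (1 : ℝ)) l = 0 := by
        simp [h0, Ne.symm hk]
      exact S.bdry _ e (ht e.ge)
    have := Dw.unique ((hasDerivAt_const (0 : ℝ) (0 : ℝ)).congr_of_eventuallyEq hz)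
    simp only [zero_smul, add_zero, Nat.cast_ofNat, Nat.add_one_sub_one, pow_one] at this
    have e : ∑ i, tg l i * (2 * pd i v y * pd k (pd i v) y) =
        2 * ∑ i, tg l i * (p i * pd k (pd i v) y) := by
      rw [Finset.mul_sum]; exact Finset.sum_congr rfl fun i _ => by simp only [hpd]; ring
    rw [e] at this
    simp only [hpd] at this ⊢
    linarith
  set c : Fin d → ℝ := fun i => p i / (1 + p l) with hcd
  suffices hB : ∃ b, HasJet (bpf l v) y (bdir l c) 0 b by
    obtain ⟨b, hb⟩ := hB
    refine ⟨c, _, _, b, fun i => ?_, ?_, (hasJet_of_contDiffAt vy (bdir l c)), hb⟩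
    · rw [hcd, abs_div, abs_of_pos hpl1, div_le_iff₀ hpl1]
      have : 1 / 2 ≤ 1 + p l := by simp only [hpd]; linarith
      have := hp i
      simp only [hpd] at *
      nlinarith
    · rw [fderiv_bdir]
      have e : ∑ i, tg l i * (c i * pd i v y) = tq l p / (1 + p l) := by
        rw [tq, Finset.sum_div]
        exact Finset.sum_congr rfl fun i _ => by simp only [hcd, hpd]; ring
      rw [e, sub_nonpos, le_div_iff₀ hpl1]
      have h4 := tq_nonneg l p
      have : 2 * p l + p l ^ 2 - tq l p = 0 := hw
      have h5 : p l * (2 + p l) = tq l p := by linarith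
      have h6 : 0 ≤ p l := by
        by_contra! h
        nlinarith
      simp only [hpd] at *
      linarith
  · have hj : ∀ i, HasJet (pd i v) y (bdir l c) _ _ := fun i => hasJet_of_contDiffAt (sy i) _
    have jq : HasJet (fun z => tq l fun i => pd i v z) y (bdir l c) _ _ :=
      HasJet.sum fun i _ => by
        simp_rw [sq]
        exact ((hj i).mul (hj i)).const_mul (tg l i)
    obtain ⟨wa, wb, jw⟩ : ∃ wa wb : ℝ,
        HasJet (fun z => bw l fun i => pd i v z) y (bdir l c) wa wb := by
      have := (((hj l).const_mul 2).add ((hj l).mul (hj l))).add (jq.const_mul (-1))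
      have e : (fun z => bw l fun i => pd i v z) = fun z => 2 * pd l v z + pd l v z * pd l v z +
          -1 * tq l (fun i => pd i v z) := by funext z; rw [bw]; ring
      rw [e]
      exact ⟨_, _, this⟩
    have := jq.add (jw.mul jw)
    have e : bpf l v = fun z => tq l (fun i => pd i v z) +
        bw l (fun i => pd i v z) * bw l (fun i => pd i v z) := by
      funext z; rw [bpf, bp]; ring
    rw [e]
    refine ⟨_, this.congr_val ?_ rfl⟩
    rw [show bw l (fun i => pd i v y) = 0 from hw, mul_zero, zero_mul, add_zero, add_zero]
    simp_rw [fderiv_bdir]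
    have e1 : ∑ i, tg l i * ((pd l (pd i v) y - ∑ k, tg l k * (c k * pd k (pd i v) y)) * pd i v y +
        pd i v y * (pd l (pd i v) y - ∑ k, tg l k * (c k * pd k (pd i v) y))) =
        2 * ∑ i, tg l i * (p i * pd l (pd i v) y) -
        2 * ∑ i, tg l i * (p i * ∑ k, tg l k * (c k * pd k (pd i v) y)) := by
      rw [Finset.mul_sum, Finset.mul_sum, ← Finset.sum_sub_distrib]
      exact Finset.sum_congr rfl fun i _ => by simp only [hpd]; ring
    have e2 : ∑ i, tg l i * (p i * ∑ k, tg l k * (c k * pd k (pd i v) y)) =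
        ∑ k, tg l k * (c k * ∑ i, tg l i * (p i * pd k (pd i v) y)) := by
      simp_rw [Finset.mul_sum]
      rw [Finset.sum_comm]
      exact Finset.sum_congr rfl fun i _ => Finset.sum_congr rfl fun k _ => by ring
    have e3 : ∑ k, tg l k * (c k * ∑ i, tg l i * (p i * pd k (pd i v) y)) =
        ∑ k, tg l k * (p k * pd l (pd k v) y) := by
      refine Finset.sum_congr rfl fun k _ => ?_
      by_cases hk : k = l
      · simp [tg, hk]
      · rw [← tang k hk, pd_comm vy k l]
        simp only [hcd]
        field_simp
    rw [e1, e2, e3]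
    ring

end Gradient

section GradientEstimate

variable {d : ℕ}

lemma norm_fderiv_sq_le (f : EuclideanSpace ℝ (Fin d) → ℝ) (y : EuclideanSpace ℝ (Fin d)) :
    ‖fderiv ℝ f y‖ ^ 2 ≤ ∑ i, pd i f y ^ 2 := by
  have h0 : 0 ≤ ∑ i, pd i f y ^ 2 := Finset.sum_nonneg fun i _ => sq_nonneg _
  have : ‖fderiv ℝ f y‖ ≤ √(∑ i, pd i f y ^ 2) := by
    refine ContinuousLinearMap.opNorm_le_bound _ (Real.sqrt_nonneg _) fun ξ => ?_
    rw [fderiv_apply_eq_sum, mul_comm, EuclideanSpace.norm_eq, ← Real.sqrt_mul (by positivity)]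
    refine Real.abs_le_sqrt ?_
    simpa using Finset.sum_mul_sq_le_sq_mul_sq Finset.univ (fun i => ξ i) fun i => pd i f y
  calc _ ≤ √(∑ i, pd i f y ^ 2) ^ 2 := pow_le_pow_left₀ (norm_nonneg _) this 2
    _ = _ := Real.sq_sqrt h0

lemma inner_tau (l : Fin d) (p : Fin d → ℝ) (m : Fin d) (z : EuclideanSpace ℝ (Fin d)) :
    inner ℝ z (tau l p m) = al l p m * z m + be l p m * z l := by
  rw [tau, inner_add_right, inner_smul_right, inner_smul_right]
  simp [EuclideanSpace.inner_single_right]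

lemma norm_tau_sq (l : Fin d) (p : Fin d → ℝ) (m : Fin d) :
    ‖tau l p m‖ ^ 2 = al l p m ^ 2 + be l p m ^ 2 := by
  rw [← real_inner_self_eq_norm_sq, inner_tau]
  by_cases hm : m = l
  · simp [tau, al, be, hm]
  · simp [tau, al, be, hm, Ne.symm hm]; ring

lemma tau_last (l : Fin d) (p : Fin d → ℝ) (m : Fin d) : tau l p m l = be l p m := by
  by_cases hm : m = l
  · simp [tau, al, be, hm]
  · simp [tau, Ne.symm hm]

/-- The cut-off function in the gradient estimate. -/
def cutoff (l : Fin d) (x : EuclideanSpace ℝ (Fin d)) (k : ℝ) (z : EuclideanSpace ℝ (Fin d)) : ℝ :=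
  1 + (-k ^ 2 * ‖z - x‖ ^ 2 + (k / 20) * (z l - x l))

lemma hasJet_coord (l : Fin d) (x y ξ : EuclideanSpace ℝ (Fin d)) :
    HasJet (fun z => z l - x l) y ξ (ξ l) 0 := by
  have := (hasJet_clm (EuclideanSpace.proj l : EuclideanSpace ℝ (Fin d) →L[ℝ] ℝ) y ξ).add
    (hasJet_const (-x l) y ξ)
  simpa [sub_eq_add_neg] using this

lemma hasJet_cutoff (l : Fin d) (x y ξ : EuclideanSpace ℝ (Fin d)) (k : ℝ) :
    HasJet (cutoff l x k) y ξ (-2 * k ^ 2 * inner ℝ (y - x) ξ + k / 20 * ξ l)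
      (-2 * k ^ 2 * ‖ξ‖ ^ 2) :=
  ((hasJet_const 1 y ξ).add (((hasJet_normSq x y ξ).const_mul (-k ^ 2)).add
    ((hasJet_coord l x y ξ).const_mul (k / 20)))).congr_val (by ring) (by ring)

lemma continuous_cutoff (l : Fin d) (x : EuclideanSpace ℝ (Fin d)) (k : ℝ) :
    Continuous (cutoff l x k) := by
  unfold cutoff; fun_prop

lemma of_cutoff_nonneg {l : Fin d} {x y : EuclideanSpace ℝ (Fin d)} {k : ℝ} (hk : 0 < k)
    (h : 0 ≤ cutoff l x k y) : k * ‖y - x‖ ≤ 21 / 20 ∧ cutoff l x k y ≤ 101 / 100 := by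
  have h1 := (abs_le.1 (abs_coord_le (y - x) l)).2
  simp only [PiLp.sub_apply] at h1
  have h2 := mul_le_mul_of_nonneg_left h1 hk.le
  have h3 : 0 ≤ k * ‖y - x‖ := by positivity
  rw [cutoff] at h ⊢
  have e : -k ^ 2 * ‖y - x‖ ^ 2 = -(k * ‖y - x‖) ^ 2 := by ring
  rw [e] at h ⊢
  set s := k * ‖y - x‖
  have e2 : k / 20 * (y l - x l) ≤ s / 20 := by linarith
  constructor
  · by_contra! hs
    nlinarith
  · nlinarith [sq_nonneg (s - 1 / 40)]

/-- Summed second-order inequality for the auxiliary function in the gradient estimate. -/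
lemma auxiliary_pos {n : ℕ} (hn : 3 ≤ n) {za zb Pa Pb va vb : Fin n → ℝ} {ζ k Q H M : ℝ}
    (hk : 0 < k) (hζ0 : 0 < ζ) (hζ1 : ζ ≤ 101 / 100) (hQ : 0 < Q) (hH : 0 ≤ H)
    (hza : ∑ m, za m ^ 2 ≤ 10 * k ^ 2) (hzb : -(21 / 10 * n * k ^ 2) ≤ ∑ m, zb m)
    (hPa : ∑ m, Pa m ^ 2 ≤ 72 * Q * H) (hPb : H / (7 * n) ≤ ∑ m, Pb m)
    (hva : 99 / 2000 * Q ≤ ∑ m, va m ^ 2) (hvb : ∑ m, vb m = 0) :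
    0 < ∑ m, ((2 * za m ^ 2 + 2 * ζ * zb m) * Q + 4 * ζ * (za m * Pa m) + ζ ^ 2 * Pb m
      + 4 * 10 ^ 5 * n * k ^ 2 * (2 * va m ^ 2 - 2 * M * vb m)) := by
  have h3 : (3 : ℝ) ≤ n := by exact_mod_cast hn
  have e : ∑ m, ((2 * za m ^ 2 + 2 * ζ * zb m) * Q + 4 * ζ * (za m * Pa m) + ζ ^ 2 * Pb m
      + 4 * 10 ^ 5 * n * k ^ 2 * (2 * va m ^ 2 - 2 * M * vb m)) =
      (2 * ∑ m, za m ^ 2 + 2 * ζ * ∑ m, zb m) * Q + 4 * ζ * (∑ m, za m * Pa m)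
      + ζ ^ 2 * (∑ m, Pb m) + 4 * 10 ^ 5 * n * k ^ 2 * (2 * ∑ m, va m ^ 2 - 2 * M * ∑ m, vb m) := by
    simp only [Finset.sum_add_distrib, Finset.sum_sub_distrib, Finset.mul_sum, Finset.sum_mul,
      mul_sub, add_mul]
  rw [e, hvb]
  set X := ∑ m, za m * Pa m with hX
  have hX2 : X ^ 2 ≤ 720 * k ^ 2 * Q * H := by
    refine (Finset.sum_mul_sq_le_sq_mul_sq _ _ _).trans ?_
    refine (mul_le_mul hza hPa (Finset.sum_nonneg fun i _ => sq_nonneg _) (by positivity)).trans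
      (le_of_eq (by ring))
  have hA : 0 ≤ ζ ^ 2 * (H / (7 * n)) := by positivity
  have hB : 0 ≤ 20160 * (n * k ^ 2 * Q) := by positivity
  have hX3 : |4 * ζ * X| ≤ ζ ^ 2 * (H / (7 * n)) + 20160 * (n * k ^ 2 * Q) := by
    refine abs_le_of_sq_le_sq ?_ (by linarith)
    have c1 : (4 * ζ * X) ^ 2 ≤ 16 * ζ ^ 2 * (720 * k ^ 2 * Q * H) := by
      rw [show (4 * ζ * X) ^ 2 = 16 * ζ ^ 2 * X ^ 2 by ring]
      exact mul_le_mul_of_nonneg_left hX2 (by positivity)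
    have c2 : 4 * (ζ ^ 2 * (H / (7 * n))) * (20160 * (n * k ^ 2 * Q)) =
        16 * ζ ^ 2 * (720 * k ^ 2 * Q * H) := by
      field_simp; ring
    nlinarith [sq_nonneg (ζ ^ 2 * (H / (7 * n)) - 20160 * (n * k ^ 2 * Q))]
  have h4 := (abs_le.1 hX3).1
  have h5 : ζ ^ 2 * (H / (7 * n)) ≤ ζ ^ 2 * ∑ m, Pb m :=
    mul_le_mul_of_nonneg_left hPb (sq_nonneg _)
  have hza0 : 0 ≤ ∑ m, za m ^ 2 := Finset.sum_nonneg fun i _ => sq_nonneg _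
  have h6 : -(5 * (n * k ^ 2 * Q)) ≤ (2 * ∑ m, za m ^ 2 + 2 * ζ * ∑ m, zb m) * Q := by
    have c1 : -(5 * (n * k ^ 2)) ≤ 2 * ζ * ∑ m, zb m := by
      have := mul_le_mul_of_nonneg_left hzb (by positivity : 0 ≤ 2 * ζ)
      have h7 : 0 ≤ (n : ℝ) * k ^ 2 := by positivity
      nlinarith
    have := mul_le_mul_of_nonneg_right (by linarith : -(5 * (n * k ^ 2)) ≤
      2 * ∑ m, za m ^ 2 + 2 * ζ * ∑ m, zb m) hQ.le
    linarith
  have h7 : 39600 * (n * k ^ 2 * Q) ≤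
      4 * 10 ^ 5 * n * k ^ 2 * (2 * ∑ m, va m ^ 2 - 2 * M * 0) := by
    have := mul_le_mul_of_nonneg_left hva (by positivity : 0 ≤ 8 * 10 ^ 5 * n * k ^ 2)
    linarith
  have h8 : 0 < (n : ℝ) * k ^ 2 * Q := by positivity
  linarith

lemma RegSol.gradient_estimate (hd : 3 ≤ d) {l : Fin d} {v : EuclideanSpace ℝ (Fin d) → ℝ}
    {W : Set (EuclideanSpace ℝ (Fin d))} (S : RegSol l v W) {x : EuclideanSpace ℝ (Fin d)}
    {r m M : ℝ} (hr : 0 < r) (hx : 0 ≤ x l)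
    (hE : ∀ y : EuclideanSpace ℝ (Fin d), 0 ≤ y l → ‖y - x‖ ≤ 2 * r → 1 ≤ ‖y‖)
    (hm : ∀ y : EuclideanSpace ℝ (Fin d), 0 ≤ y l → ‖y - x‖ ≤ 2 * r → m ≤ v y)
    (hM : ∀ y : EuclideanSpace ℝ (Fin d), 0 ≤ y l → ‖y - x‖ ≤ 2 * r → v y ≤ M) :
    ‖fderiv ℝ v x‖ ^ 2 ≤ 8 * 10 ^ 5 * d * ((M - m) / r) ^ 2 := by
  have h3 : (3 : ℝ) ≤ d := by exact_mod_cast hd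
  obtain ⟨k, hk, hkr⟩ : ∃ k : ℝ, 0 < k ∧ k * r = 1 :=
    ⟨1 / r, by positivity, by field_simp⟩
  set lam : ℝ := 4 * 10 ^ 5 * d * k ^ 2 with hlam
  have hlam0 : 0 < lam := by positivity
  set Q : EuclideanSpace ℝ (Fin d) → ℝ := fun z =>
    cutoff l x k z * cutoff l x k z * bpf l v z + lam * ((M + -1 * v z) * (M + -1 * v z)) with hQ
  set K : Set (EuclideanSpace ℝ (Fin d)) := {z | 0 ≤ z l ∧ 0 ≤ cutoff l x k z} with hK
  have hdist : ∀ z ∈ K, ‖z - x‖ < 2 * r := fun z hz => by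
    have := (of_cutoff_nonneg hk hz.2).1
    by_contra! h
    have := mul_le_mul_of_nonneg_left h hk.le
    nlinarith
  have hcl : Continuous fun z : EuclideanSpace ℝ (Fin d) => z l := by fun_prop
  have hKc : IsCompact K := by
    refine (isCompact_closedBall x (2 * r)).of_isClosed_subset ?_ fun z hz => ?_
    · exact (isClosed_le continuous_const hcl).inter
        (isClosed_le continuous_const (continuous_cutoff l x k))
    · rw [Metric.mem_closedBall, dist_eq_norm]; exact (hdist z hz).le
  have h1K : ∀ z ∈ K, 1 ≤ ‖z‖ := fun z hz => hE z hz.1 (hdist z hz).le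
  have hKW : K ⊆ W := fun z hz => S.mem z hz.1 (h1K z hz)
  have hQc : ContinuousOn Q K := by
    have c1 : ∀ i, ContinuousOn (pd i v) K := fun i =>
      (contDiffOn_pd S.isOpen S.smooth i).continuousOn.mono hKW
    have c2 : ContinuousOn v K := S.smooth.continuousOn.mono hKW
    have c3 : ContinuousOn (bpf l v) K := by
      unfold bpf bp bw tq
      fun_prop
    have c4 := (continuous_cutoff l x k).continuousOn (s := K)
    fun_prop
  have hζx : cutoff l x k x = 1 := by simp [cutoff]
  have hxK : x ∈ K := ⟨hx, by rw [hζx]; norm_num⟩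
  obtain ⟨y, hyK, hymax⟩ := hKc.exists_isMaxOn ⟨x, hxK⟩ hQc
  have hQx : bpf l v x ≤ Q y := by
    have : Q x ≤ Q y := hymax hxK
    refine le_trans ?_ this
    simp only [hQ, hζx]
    nlinarith [mul_self_nonneg (M + -1 * v x)]
  have hvm : m ≤ v y := hm y hyK.1 (hdist y hyK).le
  have hvM : v y ≤ M := hM y hyK.1 (hdist y hyK).le
  -- it suffices to see that the first term vanishes at the maximum point
  suffices h0 : cutoff l x k y = 0 ∨ bpf l v y = 0 by
    have e : Q y = lam * (M - v y) ^ 2 := by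
      rcases h0 with h0 | h0 <;> simp only [hQ, h0] <;> ring
    have h1 : (M - v y) ^ 2 ≤ (M - m) ^ 2 := by nlinarith
    have h2 := sum_sq_le_bp hd (S.abs_pd_le hx (h1K x hxK)) l
    have h4 := norm_fderiv_sq_le v x
    have h5 : bpf l v x ≤ lam * (M - m) ^ 2 := by
      rw [e] at hQx
      exact hQx.trans (mul_le_mul_of_nonneg_left h1 hlam0.le)
    have h6 : ((M - m) / r) ^ 2 = k ^ 2 * (M - m) ^ 2 := by
      rw [div_pow, div_eq_iff (by positivity)]
      linear_combination (-(M - m) ^ 2 * (k * r + 1)) * hkr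
    have h7 : bpf l v x = bp l fun i => pd i v x := rfl
    rw [h6, hlam] at *
    linarith
  by_contra! hne
  have hζ0 : 0 < cutoff l x k y := lt_of_le_of_ne hyK.2 (Ne.symm hne.1)
  have hP0 : 0 < bpf l v y := lt_of_le_of_ne (bp_nonneg _ _) (Ne.symm hne.2)
  have hyW := hKW hyK
  have hp := S.abs_pd_le hyK.1 (h1K y hyK)
  have hζc : ∀ᶠ z in 𝓝 y, 0 < cutoff l x k z :=
    (continuous_cutoff l x k).continuousAt.eventually (lt_mem_nhds hζ0)
  have hnear : ∀ᶠ z in 𝓝 y, 0 ≤ z l → 1 ≤ ‖z‖ := by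
    filter_upwards [hζc] with z hz hz0 using h1K z ⟨hz0, hz.le⟩
  rcases hyK.1.lt_or_eq with hpos | hzero
  · -- interior maximum
    have hloc : IsLocalMax Q y := by
      filter_upwards [hζc, hcl.continuousAt.eventually (lt_mem_nhds hpos)] with z hz hz0
      exact hymax (show z ∈ K from ⟨hz0.le, hz.le⟩)
    have heq : ∀ᶠ z in 𝓝 y, opL l (fun i => pd i v z) (fun i j => pd j (pd i v) z) = 0 := by
      filter_upwards [hnear, hcl.continuousAt.eventually (lt_mem_nhds hpos)] with z hz hz0
      exact S.eqn z hz0 (hz hz0.le)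
    obtain ⟨H, Pa, Pb, hH, hPj, hPb, hPa⟩ := bernstein hd S.isOpen S.smooth hyW l hp heq
    set p : Fin d → ℝ := fun i => pd i v y with hpd
    have hζj := fun i => hasJet_cutoff l x y (tau l p i) k
    have hvj := fun i => hasJet_tau (contDiffAt_two S.isOpen S.smooth hyW) l p i
    set za : Fin d → ℝ := fun i =>
      -2 * k ^ 2 * inner ℝ (y - x) (tau l p i) + k / 20 * tau l p i l with hza
    set va : Fin d → ℝ := fun i => al l p i * pd i v y + be l p i * pd l v y with hva
    set vb : Fin d → ℝ := fun i => al l p i ^ 2 * pd i (pd i v) y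
      + 2 * al l p i * be l p i * pd l (pd i v) y + be l p i ^ 2 * pd l (pd l v) y with hvb
    have hvb0 : ∑ i, vb i = 0 := heq.self_of_nhds
    have hyx := of_cutoff_nonneg hk hyK.2
    have b1 : ∑ i, za i ^ 2 ≤ 10 * k ^ 2 := by
      have e : ∑ i, za i ^ 2 =
          qf l p fun i => -2 * k ^ 2 * (y - x) i + if i = l then k / 20 else 0 := by
        refine Finset.sum_congr rfl fun i _ => ?_
        simp only [hza]
        rw [inner_tau, tau_last]
        by_cases hi : i = l
        · simp [al, be, hi]
        · simp only [al, be, hi, if_false, if_true]; ring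
      rw [e]
      refine (qf_le hd hp l _).trans ?_
      have e2 : ∑ i, (-2 * k ^ 2 * (y - x) i + if i = l then k / 20 else 0) ^ 2 ≤
          ∑ i, (8 * k ^ 4 * (y - x) i ^ 2 + if i = l then 2 * (k / 20) ^ 2 else 0) := by
        refine Finset.sum_le_sum fun i _ => ?_
        split_ifs
        · nlinarith [sq_nonneg (-2 * k ^ 2 * (y - x) i - k / 20)]
        · nlinarith [sq_nonneg (k ^ 2 * (y - x) i)]
      rw [Finset.sum_add_distrib, ← Finset.mul_sum, ← EuclideanSpace.real_norm_sq_eq] at e2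
      simp only [Finset.sum_ite_eq', Finset.mem_univ, if_true] at e2
      have e3 : k ^ 4 * ‖y - x‖ ^ 2 ≤ 441 / 400 * k ^ 2 := by
        have : (k * ‖y - x‖) ^ 2 ≤ (21 / 20) ^ 2 :=
          pow_le_pow_left₀ (by positivity) hyx.1 2
        nlinarith [mul_le_mul_of_nonneg_left this (sq_nonneg k)]
      nlinarith [sq_nonneg k]
    have b2 : -(21 / 10 * d * k ^ 2) ≤ ∑ i, -2 * k ^ 2 * ‖tau l p i‖ ^ 2 := by
      simp_rw [norm_tau_sq]
      rw [← Finset.mul_sum]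
      have := (abs_le.1 (abs_frame_sub_le hd hp l)).2
      have h7 : ∑ i, (al l p i ^ 2 + be l p i ^ 2) ≤ 21 / 20 * d := by linarith
      nlinarith [mul_le_mul_of_nonneg_left h7 (sq_nonneg k)]
    have b3 : 99 / 2000 * bpf l v y ≤ ∑ i, va i ^ 2 := by
      have h7 := bp_le_sum_sq hd hp l
      have h8 : 99 / 100 * ∑ i, p i ^ 2 ≤ ∑ i, va i ^ 2 := le_qf hd hp l p
      have h9 : bpf l v y = bp l p := rfl
      rw [h9]; linarith
    have key := auxiliary_pos hd (M := M - v y) hk hζ0 hyx.2 hP0 hH b1 b2 hPa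
      hPb b3 hvb0
    have : ∀ i, (2 * za i ^ 2 + 2 * cutoff l x k y * (-2 * k ^ 2 * ‖tau l p i‖ ^ 2)) * bpf l v y
        + 4 * cutoff l x k y * (za i * Pa i) + cutoff l x k y ^ 2 * Pb i
        + 4 * 10 ^ 5 * d * k ^ 2 * (2 * va i ^ 2 - 2 * (M - v y) * vb i) ≤ 0 := fun i => by
      have j1 := (hasJet_const M y (tau l p i)).add ((hvj i).const_mul (-1))
      have j := (((hζj i).mul (hζj i)).mul (hPj i)).add ((j1.mul j1).const_mul lam)
      have := j.nonpos_of_isLocalMax hloc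
      refine le_trans (le_of_eq ?_) this
      simp only [hza, hva, hvb, hlam]
      ring
    exact absurd (Finset.sum_nonpos fun i _ => this i) (not_le.2 key)
  · -- boundary maximum
    obtain ⟨c, av, bv, b, hc, hav, hvj, hPj⟩ := S.boundary_jet hd hzero.symm hnear
    have hζj := hasJet_cutoff l x y (bdir l c) k
    have j1 := (hasJet_const M y (bdir l c)).add (hvj.const_mul (-1))
    have j := ((hζj.mul hζj).mul hPj).add ((j1.mul j1).const_mul lam)
    have hray : ∀ᶠ t in 𝓝[>] (0 : ℝ), Q (y + t • bdir l c) ≤ Q y := by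
      have hc : Tendsto (fun t : ℝ => y + t • bdir l c) (𝓝[>] (0 : ℝ)) (𝓝 y) := by
        have : Continuous (fun t : ℝ => y + t • bdir l c) := by fun_prop
        have h := this.tendsto 0
        simp only [zero_smul, add_zero] at h
        exact h.mono_left nhdsWithin_le_nhds
      filter_upwards [hc.eventually hζc, self_mem_nhdsWithin] with t ht ht0
      refine hymax (show _ ∈ K from ⟨?_, ht.le⟩)
      have ht0' : 0 < t := ht0
      simp [bdir_last, ← hzero, ht0'.le]
    have := j.nonpos_of_ray hray
    rw [inner_bdir, bdir_last] at this
    have t1 := abs_tangential_le hd l hc (y - x)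
    have t2 := (of_cutoff_nonneg hk hyK.2).1
    have t3 : (y - x) l ≤ 0 := by simp [← hzero, hx]
    set T := ∑ i, tg l i * (c i * (y - x) i)
    have t4 : 0 < -2 * k ^ 2 * ((y - x) l - T) + k / 20 * 1 := by
      have e1 : k * -T ≤ 21 / 200000 := by
        have := mul_le_mul_of_nonneg_left ((neg_abs_le T).trans' (neg_le_neg t1)) hk.le
        linarith
      have e2 : 0 ≤ k * (-(y - x) l) := by nlinarith
      have e3 : 0 < 1 / 20 + 2 * (k * (-(y - x) l)) - 2 * (k * -T) := by linarith
      have := mul_pos hk e3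
      linarith
    have t5 := mul_pos (mul_pos t4 hζ0) hP0
    have t6 : 0 ≤ lam * ((M - v y) * -av) := by
      have : 0 ≤ M - v y := by linarith
      have : 0 ≤ -av := by linarith
      positivity
    linarith

end GradientEstimate

section Barriers

variable {d : ℕ}

/-- `φ` is a strict subsolution at `y` of every linear oblique problem with coefficients close to
those of the Neumann problem for the Laplacian. -/
def StrictSub (l : Fin d) (φ : EuclideanSpace ℝ (Fin d) → ℝ) (y : EuclideanSpace ℝ (Fin d)) :
    Prop :=
  (∀ p : Fin d → ℝ, (∀ i, |p i| ≤ eta d) → ∃ a b : Fin d → ℝ,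
      (∀ i, HasJet φ y (tau l p i) (a i) (b i)) ∧ 0 < ∑ i, b i) ∧
    (y l = 0 → ∀ c : Fin d → ℝ, (∀ i, |c i| ≤ 2 * eta d) → ∃ a b : ℝ,
      HasJet φ y (bdir l c) a b ∧ 0 < a)

lemma StrictSub.add {l : Fin d} {φ ψ : EuclideanSpace ℝ (Fin d) → ℝ}
    {y : EuclideanSpace ℝ (Fin d)} (h : StrictSub l φ y) (k : StrictSub l ψ y) :
    StrictSub l (fun z => φ z + ψ z) y := by
  refine ⟨fun p hp => ?_, fun h0 c hc => ?_⟩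
  · obtain ⟨a, b, h1, h2⟩ := h.1 p hp
    obtain ⟨a', b', k1, k2⟩ := k.1 p hp
    exact ⟨_, _, fun i => (h1 i).add (k1 i), by rw [Finset.sum_add_distrib]; exact add_pos h2 k2⟩
  · obtain ⟨a, b, h1, h2⟩ := h.2 h0 c hc
    obtain ⟨a', b', k1, k2⟩ := k.2 h0 c hc
    exact ⟨_, _, h1.add k1, add_pos h2 k2⟩

lemma StrictSub.const_mul {l : Fin d} {φ : EuclideanSpace ℝ (Fin d) → ℝ}
    {y : EuclideanSpace ℝ (Fin d)} (h : StrictSub l φ y) {A : ℝ} (hA : 0 < A) :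
    StrictSub l (fun z => A * φ z) y := by
  refine ⟨fun p hp => ?_, fun h0 c hc => ?_⟩
  · obtain ⟨a, b, h1, h2⟩ := h.1 p hp
    exact ⟨_, _, fun i => (h1 i).const_mul A, by rw [← Finset.mul_sum]; exact mul_pos hA h2⟩
  · obtain ⟨a, b, h1, h2⟩ := h.2 h0 c hc
    exact ⟨_, _, h1.const_mul A, mul_pos hA h2⟩

/-- A perturbed distance function. -/
def pdist (l : Fin d) (θ : ℝ) (x z : EuclideanSpace ℝ (Fin d)) : ℝ := ‖z - x‖ + θ * (z l - x l)

lemma continuous_pdist (l : Fin d) (θ : ℝ) (x : EuclideanSpace ℝ (Fin d)) :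
    Continuous (pdist l θ x) := by
  unfold pdist; fun_prop

lemma abs_pdist_sub_le (l : Fin d) {θ : ℝ} (hθ : |θ| ≤ 1 / 20) (x z : EuclideanSpace ℝ (Fin d)) :
    |pdist l θ x z - ‖z - x‖| ≤ 1 / 20 * ‖z - x‖ := by
  rw [pdist, add_sub_cancel_left, abs_mul]
  exact mul_le_mul hθ (by simpa using abs_coord_le (z - x) l) (abs_nonneg _) (by norm_num)

lemma pdist_pos (l : Fin d) {θ : ℝ} (hθ : |θ| ≤ 1 / 20) {x z : EuclideanSpace ℝ (Fin d)}
    (h : z ≠ x) : 0 < pdist l θ x z := by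
  have h1 := (abs_le.1 (abs_pdist_sub_le l hθ x z)).1
  have h2 : 0 < ‖z - x‖ := norm_pos_iff.2 (sub_ne_zero.2 h)
  linarith

lemma hasJet_pdist_rpow (l : Fin d) {θ : ℝ} (hθ : |θ| ≤ 1 / 20) {x y : EuclideanSpace ℝ (Fin d)}
    (h : y ≠ x) (e : ℝ) (ξ : EuclideanSpace ℝ (Fin d)) :
    HasJet (fun z => pdist l θ x z ^ e) y ξ
      (e * pdist l θ x y ^ (e - 1) * (inner ℝ (y - x) ξ / ‖y - x‖ + θ * ξ l))
      (e * pdist l θ x y ^ (e - 2) * ((e - 1) * (inner ℝ (y - x) ξ / ‖y - x‖ + θ * ξ l) ^ 2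
        + pdist l θ x y * ((‖ξ‖ ^ 2 - (inner ℝ (y - x) ξ / ‖y - x‖) ^ 2) / ‖y - x‖))) := by
  have hg := pdist_pos l hθ h
  have hj : HasJet (pdist l θ x) y ξ _ _ :=
    (hasJet_norm h ξ).add ((hasJet_coord l x y ξ).const_mul θ)
  have h1 : ∀ᶠ s in 𝓝 (pdist l θ x y), HasDerivAt (fun s : ℝ => s ^ e) (e * s ^ (e - 1)) s := by
    filter_upwards [lt_mem_nhds hg] with s hs
    exact Real.hasDerivAt_rpow_const (Or.inl hs.ne')
  have h2 : HasDerivAt (fun s : ℝ => e * s ^ (e - 1))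
      (e * ((e - 1) * pdist l θ x y ^ (e - 1 - 1))) (pdist l θ x y) :=
    (Real.hasDerivAt_rpow_const (Or.inl hg.ne')).const_mul e
  refine (hj.comp h1 h2).congr_val rfl ?_
  have e1 : pdist l θ x y ^ (e - 1) = pdist l θ x y ^ (e - 2) * pdist l θ x y := by
    rw [← Real.rpow_add_one hg.ne']; congr 1; ring
  have e2 : e - 1 - 1 = e - 2 := by ring
  rw [e1, e2]
  ring

/-- Trace bounds for the perturbed distance. -/
lemma pdist_trace (hd : 3 ≤ d) (l : Fin d) {θ : ℝ} (hθ : |θ| ≤ 1 / 20)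
    {x y : EuclideanSpace ℝ (Fin d)} (h : y ≠ x) {p : Fin d → ℝ} (hp : ∀ i, |p i| ≤ eta d) :
    (89 / 100 ≤ ∑ i, (inner ℝ (y - x) (tau l p i) / ‖y - x‖ + θ * tau l p i l) ^ 2 ∧
      ∑ i, (inner ℝ (y - x) (tau l p i) / ‖y - x‖ + θ * tau l p i l) ^ 2 ≤ 112 / 100) ∧
    95 / 100 * (d - 102 / 100) ≤ ∑ i, pdist l θ x y *
      ((‖tau l p i‖ ^ 2 - (inner ℝ (y - x) (tau l p i) / ‖y - x‖) ^ 2) / ‖y - x‖) ∧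
    ∑ i, pdist l θ x y *
      ((‖tau l p i‖ ^ 2 - (inner ℝ (y - x) (tau l p i) / ‖y - x‖) ^ 2) / ‖y - x‖) ≤
        105 / 100 * (d - 98 / 100) := by
  have h3 : (3 : ℝ) ≤ d := by exact_mod_cast hd
  have hN : 0 < ‖y - x‖ := norm_pos_iff.2 (sub_ne_zero.2 h)
  have hg := abs_le.1 (abs_pdist_sub_le l hθ x y)
  set N := ‖y - x‖ with hNd
  set u : Fin d → ℝ := fun i => (y - x) i / N with hu
  have hu1 : ∑ i, u i ^ 2 = 1 := by
    simp only [hu, div_pow]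
    rw [← Finset.sum_div, ← EuclideanSpace.real_norm_sq_eq, ← hNd]
    field_simp
  have hul : |u l| ≤ 1 := by
    rw [hu, abs_div, abs_of_pos hN, div_le_one hN]
    exact abs_coord_le (y - x) l
  have e0 : ∀ i, inner ℝ (y - x) (tau l p i) / N = al l p i * u i + be l p i * u l := fun i => by
    rw [inner_tau]; simp only [hu]; ring
  have e1 : ∑ i, (inner ℝ (y - x) (tau l p i) / N + θ * tau l p i l) ^ 2 =
      qf l p fun i => u i + if i = l then θ else 0 := by
    refine Finset.sum_congr rfl fun i _ => ?_
    rw [e0, tau_last]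
    by_cases hi : i = l
    · simp [al, be, hi]
    · simp only [al, be, hi, if_false, if_true]; ring
  have e2 : ∑ i, (u i + if i = l then θ else 0) ^ 2 = 1 + 2 * θ * u l + θ ^ 2 := by
    have : ∀ i, (u i + if i = l then θ else 0) ^ 2 =
        u i ^ 2 + if i = l then 2 * θ * u l + θ ^ 2 else 0 := fun i => by
      split_ifs with hi
      · rw [hi]; ring
      · ring
    simp_rw [this]
    rw [Finset.sum_add_distrib, hu1]
    simp; ring
  have hθu : |θ * u l| ≤ 1 / 20 := by
    rw [abs_mul]
    calc _ ≤ 1 / 20 * 1 := mul_le_mul hθ hul (abs_nonneg _) (by norm_num)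
      _ = _ := by norm_num
  have hθ2 : θ ^ 2 ≤ 1 / 400 := by nlinarith [abs_le.1 hθ]
  have e3 : ∑ i, pdist l θ x y * ((‖tau l p i‖ ^ 2 - (inner ℝ (y - x) (tau l p i) / N) ^ 2) / N) =
      pdist l θ x y / N * (∑ i, (al l p i ^ 2 + be l p i ^ 2) - qf l p u) := by
    rw [qf, ← Finset.sum_sub_distrib, Finset.mul_sum]
    refine Finset.sum_congr rfl fun i _ => ?_
    rw [norm_tau_sq, e0]; ring
  have q1 := qf_le hd hp l u
  have q2 := le_qf hd hp l u
  have q3 := qf_le hd hp l fun i => u i + if i = l then θ else 0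
  have q4 := le_qf hd hp l fun i => u i + if i = l then θ else 0
  have q5 := abs_le.1 (abs_frame_sub_le hd hp l)
  rw [hu1] at q1 q2
  rw [e2] at q3 q4
  have hθu' := abs_le.1 hθu
  have g1 : 95 / 100 ≤ pdist l θ x y / N := by rw [le_div_iff₀ hN]; linarith
  have g2 : pdist l θ x y / N ≤ 105 / 100 := by rw [div_le_iff₀ hN]; linarith
  rw [e1, e3]
  refine ⟨⟨?_, ?_⟩, ?_, ?_⟩
  · nlinarith [sq_nonneg θ]
  · linarith
  · exact mul_le_mul g1 (by linarith) (by linarith) (by linarith)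
  · exact mul_le_mul g2 (by linarith) (by linarith) (by linarith)

/-- The slowly decaying barrier. -/
lemma strictSub_slow (hd : 3 ≤ d) (l : Fin d) {x y : EuclideanSpace ℝ (Fin d)} (h : y ≠ x)
    (hx : x l = 0) : StrictSub l (fun z => -1 * pdist l (1 / 20) x z ^ (-1 / 2 : ℝ)) y := by
  have h3 : (3 : ℝ) ≤ d := by exact_mod_cast hd
  have hθ : |(1 / 20 : ℝ)| ≤ 1 / 20 := abs_of_pos (by norm_num : (0 : ℝ) < 1 / 20) |>.le
  have hg := pdist_pos l hθ h
  have hN : 0 < ‖y - x‖ := norm_pos_iff.2 (sub_ne_zero.2 h)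
  refine ⟨fun p hp => ⟨_, _, fun i => (hasJet_pdist_rpow l hθ h _ _).const_mul (-1), ?_⟩,
    fun h0 c hc => ⟨_, _, (hasJet_pdist_rpow l hθ h _ _).const_mul (-1), ?_⟩⟩
  · have t := pdist_trace hd l hθ h hp
    rw [← Finset.mul_sum, ← Finset.mul_sum, Finset.sum_add_distrib, ← Finset.mul_sum]
    have hpow := Real.rpow_pos_of_pos hg (-1 / 2 - 2)
    rw [show ∀ s t : ℝ, -1 * (-1 / 2 * s * t) = s * (1 / 2 * t) by intros; ring]
    refine mul_pos hpow ?_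
    linarith [t.1.2, t.2.1]
  · have hpow := Real.rpow_pos_of_pos hg (-1 / 2 - 1)
    rw [show ∀ s t : ℝ, -1 * (-1 / 2 * s * t) = s * (1 / 2 * t) by intros; ring]
    refine mul_pos hpow (mul_pos (by norm_num) ?_)
    rw [inner_bdir, bdir_last]
    have t1 := (abs_le.1 (abs_tangential_le hd l hc (y - x))).2
    have t2 : (y - x) l = 0 := by simp [h0, hx]
    have : -(1 / 10000) ≤ ((y - x) l - ∑ i, tg l i * (c i * (y - x) i)) / ‖y - x‖ := by
      rw [le_div_iff₀ hN]; linarith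
    linarith

/-- The fast decaying barrier. -/
lemma strictSub_fast (hd : 3 ≤ d) (l : Fin d) {x y : EuclideanSpace ℝ (Fin d)} (h : y ≠ x)
    (hx : 0 ≤ x l) : StrictSub l (fun z => pdist l (-1 / 20) x z ^ (-(2 * d) : ℝ)) y := by
  have h3 : (3 : ℝ) ≤ d := by exact_mod_cast hd
  have hθ : |(-1 / 20 : ℝ)| ≤ 1 / 20 := by rw [abs_le]; norm_num
  have hg := pdist_pos l hθ h
  have hN : 0 < ‖y - x‖ := norm_pos_iff.2 (sub_ne_zero.2 h)
  refine ⟨fun p hp => ⟨_, _, fun i => hasJet_pdist_rpow l hθ h _ _, ?_⟩,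
    fun h0 c hc => ⟨_, _, hasJet_pdist_rpow l hθ h _ _, ?_⟩⟩
  · have t := pdist_trace hd l hθ h hp
    rw [← Finset.mul_sum, Finset.sum_add_distrib, ← Finset.mul_sum]
    have hpow := Real.rpow_pos_of_pos hg (-(2 * d) - 2)
    rw [show ∀ s t : ℝ, -(2 * (d : ℝ)) * s * t = s * (2 * d * -t) by intros; ring]
    refine mul_pos hpow (mul_pos (by linarith) ?_)
    nlinarith [t.1.1, t.2.2]
  · have hpow := Real.rpow_pos_of_pos hg (-(2 * d) - 1)
    rw [show ∀ s t : ℝ, -(2 * (d : ℝ)) * s * t = s * (2 * d * -t) by intros; ring]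
    refine mul_pos hpow (mul_pos (by linarith) ?_)
    rw [inner_bdir, bdir_last]
    have t1 := (abs_le.1 (abs_tangential_le hd l hc (y - x))).1
    have t2 : (y - x) l ≤ 0 := by simp [h0, hx]
    have : ((y - x) l - ∑ i, tg l i * (c i * (y - x) i)) / ‖y - x‖ ≤ 1 / 10000 := by
      rw [div_le_iff₀ hN]; linarith
    linarith

lemma continuousOn_pdist_rpow (l : Fin d) {θ : ℝ} (hθ : |θ| ≤ 1 / 20)
    {x : EuclideanSpace ℝ (Fin d)} {K : Set (EuclideanSpace ℝ (Fin d))} (hK : ∀ y ∈ K, y ≠ x)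
    (e : ℝ) : ContinuousOn (fun z => pdist l θ x z ^ e) K :=
  (continuous_pdist l θ x).continuousOn.rpow_const fun y hy => Or.inl (pdist_pos l hθ (hK y hy)).ne'

/-- Comparison of a solution with a strict subsolution. -/
lemma RegSol.comparison (hd : 3 ≤ d) {l : Fin d} {v : EuclideanSpace ℝ (Fin d) → ℝ}
    {W : Set (EuclideanSpace ℝ (Fin d))} (S : RegSol l v W) {K Γ : Set (EuclideanSpace ℝ (Fin d))}
    (hK : IsCompact K) (hKe : ∀ y ∈ K, 0 ≤ y l ∧ 1 ≤ ‖y‖) {φ : EuclideanSpace ℝ (Fin d) → ℝ}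
    (hφ : ContinuousOn φ K)
    (hin : ∀ y ∈ K, y ∉ Γ → (∀ᶠ z in 𝓝 y, 0 ≤ z l → z ∈ K) ∧ StrictSub l φ y) (σ : ℝ)
    {y : EuclideanSpace ℝ (Fin d)} (hy : y ∈ K) :
    ∃ z ∈ K, z ∈ Γ ∧ σ * v y + φ y ≤ σ * v z + φ z := by
  have hc : ContinuousOn (fun z => σ * v z + φ z) K :=
    (continuousOn_const.mul (S.smooth.continuousOn.mono fun z hz =>
      S.mem z (hKe z hz).1 (hKe z hz).2)).add hφ
  obtain ⟨z, hz, hmax⟩ := hK.exists_isMaxOn ⟨y, hy⟩ hc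
  refine ⟨z, hz, ?_, hmax hy⟩
  by_contra hΓ
  obtain ⟨hnear, hsub⟩ := hin z hz hΓ
  obtain ⟨hz0, hz1⟩ := hKe z hz
  have hp := S.abs_pd_le hz0 hz1
  have vz := contDiffAt_two S.isOpen S.smooth (S.mem z hz0 hz1)
  have hcl : Continuous fun z : EuclideanSpace ℝ (Fin d) => z l := by fun_prop
  rcases hz0.lt_or_eq with hpos | hzero
  · have hloc : IsLocalMax (fun z => σ * v z + φ z) z := by
      filter_upwards [hnear, hcl.continuousAt.eventually (lt_mem_nhds hpos)] with w hw hw0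
      exact hmax (hw hw0.le)
    obtain ⟨a, b, h1, h2⟩ := hsub.1 _ hp
    have h3 : ∀ i, σ * _ + b i ≤ 0 := fun i =>
      ((((hasJet_tau vz l (fun i => pd i v z) i).const_mul σ).add (h1 i)).nonpos_of_isLocalMax hloc)
    have h4 := Finset.sum_nonpos (s := Finset.univ) fun i _ => h3 i
    rw [Finset.sum_add_distrib, ← Finset.mul_sum] at h4
    have h5 := S.eqn z hpos hz1
    rw [opL] at h5
    rw [h5, mul_zero] at h4
    linarith
  · have hpl := abs_le.1 (hp l)
    have he0 := eta_pos hd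
    have he1 := eta_le hd
    have hw : bw l (fun i => pd i v z) = 0 := S.bdry z hzero.symm hz1
    have h2l : 0 < 2 + pd l v z := by linarith
    obtain ⟨a, b, h1, h2⟩ := hsub.2 hzero.symm (fun i => pd i v z / (2 + pd l v z)) fun i => by
      rw [abs_div, abs_of_pos h2l, div_le_iff₀ h2l]
      nlinarith [hp i]
    have hdv : fderiv ℝ v z (bdir l fun i => pd i v z / (2 + pd l v z)) = 0 := by
      rw [fderiv_bdir]
      have e : ∑ i, tg l i * (pd i v z / (2 + pd l v z) * pd i v z) =
          tq l (fun i => pd i v z) / (2 + pd l v z) := by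
        rw [tq, Finset.sum_div]
        exact Finset.sum_congr rfl fun i _ => by ring
      rw [bw] at hw
      rw [e, sub_eq_zero, eq_div_iff h2l.ne']
      linarith
    have hj := ((hasJet_of_contDiffAt vz _).const_mul σ).add h1
    rw [hdv] at hj
    have := hj.nonpos_of_ray (by
      have hc : Tendsto (fun t : ℝ => z + t • bdir l fun i => pd i v z / (2 + pd l v z))
          (𝓝[>] (0 : ℝ)) (𝓝 z) := by
        have : Continuous (fun t : ℝ => z + t • bdir l fun i => pd i v z / (2 + pd l v z)) := by
          fun_prop
        have h := this.tendsto 0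
        simp only [zero_smul, add_zero] at h
        exact h.mono_left nhdsWithin_le_nhds
      filter_upwards [hc.eventually hnear, self_mem_nhdsWithin] with t ht ht0
      have ht0' : 0 < t := ht0
      exact hmax (ht (by simp [bdir_last, ← hzero, ht0'.le])))
    linarith

end Barriers

section Annuli

variable {d : ℕ}

lemma isClosed_halfSpace (l : Fin d) : IsClosed {y : EuclideanSpace ℝ (Fin d) | 0 ≤ y l} :=
  isClosed_le continuous_const (by fun_prop)

lemma isCompact_halfAnnulus (l : Fin d) (R₀ R₁ : ℝ) :
    IsCompact {y : EuclideanSpace ℝ (Fin d) | 0 ≤ y l ∧ R₀ ≤ ‖y‖ ∧ ‖y‖ ≤ R₁} := by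
  refine (isCompact_closedBall (0 : EuclideanSpace ℝ (Fin d)) R₁).of_isClosed_subset
    ((isClosed_halfSpace l).inter ((isClosed_le continuous_const continuous_norm).inter
      (isClosed_le continuous_norm continuous_const))) fun y hy => ?_
  simpa using hy.2.2

lemma pdist_zero_bounds (l : Fin d) {y : EuclideanSpace ℝ (Fin d)} (hy : 0 ≤ y l) :
    ‖y‖ ≤ pdist l (1 / 20) 0 y ∧ pdist l (1 / 20) 0 y ≤ 21 / 20 * ‖y‖ := by
  have h := (abs_le.1 (abs_coord_le y l)).2
  simp only [pdist, sub_zero, PiLp.zero_apply]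
  constructor <;> linarith

lemma slow_le (l : Fin d) {y : EuclideanSpace ℝ (Fin d)} (hy : 0 ≤ y l) (h : y ≠ 0) :
    pdist l (1 / 20) 0 y ^ (-1 / 2 : ℝ) ≤ ‖y‖ ^ (-1 / 2 : ℝ) :=
  Real.rpow_le_rpow_of_nonpos (norm_pos_iff.2 h) (pdist_zero_bounds l hy).1 (by norm_num)

lemma le_slow (l : Fin d) {y : EuclideanSpace ℝ (Fin d)} (hy : 0 ≤ y l) (h : y ≠ 0) :
    (21 / 20 * ‖y‖) ^ (-1 / 2 : ℝ) ≤ pdist l (1 / 20) 0 y ^ (-1 / 2 : ℝ) :=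
  Real.rpow_le_rpow_of_nonpos ((norm_pos_iff.2 h).trans_le (pdist_zero_bounds l hy).1)
    (pdist_zero_bounds l hy).2 (by norm_num)

/-- Comparison with the slow barrier on a half annulus. -/
lemma RegSol.annulus_comparison (hd : 3 ≤ d) {l : Fin d} {v : EuclideanSpace ℝ (Fin d) → ℝ}
    {W : Set (EuclideanSpace ℝ (Fin d))} (S : RegSol l v W) {R₀ R₁ : ℝ} (hR₀ : 1 ≤ R₀)
    (σ : ℝ) {c : ℝ} (hc : 0 < c) {y : EuclideanSpace ℝ (Fin d)} (hy : 0 ≤ y l) (hy₀ : R₀ ≤ ‖y‖)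
    (hy₁ : ‖y‖ ≤ R₁) :
    ∃ z : EuclideanSpace ℝ (Fin d), 0 ≤ z l ∧ (‖z‖ = R₀ ∨ ‖z‖ = R₁) ∧
      σ * v y ≤ σ * v z + c * (pdist l (1 / 20) 0 y ^ (-1 / 2 : ℝ) -
        pdist l (1 / 20) 0 z ^ (-1 / 2 : ℝ)) := by
  have hne : ∀ z : EuclideanSpace ℝ (Fin d), R₀ ≤ ‖z‖ → z ≠ 0 := fun z hz => by
    rw [← norm_pos_iff]; linarith
  have hnear : ∀ z : EuclideanSpace ℝ (Fin d), R₀ ≤ ‖z‖ → ‖z‖ ≤ R₁ → ¬ (‖z‖ = R₀ ∨ ‖z‖ = R₁) →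
      ∀ᶠ w in 𝓝 z, 0 ≤ w l → 0 ≤ w l ∧ R₀ ≤ ‖w‖ ∧ ‖w‖ ≤ R₁ := fun z hz0 hz1 hz => by
    have h0 : R₀ < ‖z‖ := hz0.lt_of_ne fun h => hz (Or.inl h.symm)
    have h1 : ‖z‖ < R₁ := hz1.lt_of_ne fun h => hz (Or.inr h)
    filter_upwards [continuous_norm.continuousAt.eventually (lt_mem_nhds h0),
      continuous_norm.continuousAt.eventually (gt_mem_nhds h1)] with w hw0 hw1 hw
    exact ⟨hw, hw0.le, hw1.le⟩
  obtain ⟨z, ⟨hz, -⟩, hzΓ, h⟩ := S.comparison hd (isCompact_halfAnnulus l R₀ R₁)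
    (Γ := {z | ‖z‖ = R₀ ∨ ‖z‖ = R₁})
    (φ := fun z => c * (-1 * pdist l (1 / 20) 0 z ^ (-1 / 2 : ℝ)))
    (fun z hz => ⟨hz.1, hR₀.trans hz.2.1⟩)
    (continuousOn_const.mul (continuousOn_const.mul (continuousOn_pdist_rpow l
      (abs_of_pos (by norm_num : (0 : ℝ) < 1 / 20)).le (fun z hz => hne z hz.2.1) _)))
    (fun z hz hzΓ => ⟨hnear z hz.2.1 hz.2.2 hzΓ,
      (strictSub_slow hd l (hne z hz.2.1) rfl).const_mul hc⟩) σ ⟨hy, hy₀, hy₁⟩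
  exact ⟨z, hz, hzΓ, by linarith⟩

/-- The maximum principle on half annuli. -/
lemma RegSol.le_of_spheres (hd : 3 ≤ d) {l : Fin d} {v : EuclideanSpace ℝ (Fin d) → ℝ}
    {W : Set (EuclideanSpace ℝ (Fin d))} (S : RegSol l v W) {R₀ R₁ M : ℝ} (hR₀ : 1 ≤ R₀) (σ : ℝ)
    (h₀ : ∀ y : EuclideanSpace ℝ (Fin d), 0 ≤ y l → ‖y‖ = R₀ → σ * v y ≤ M)
    (h₁ : ∀ y : EuclideanSpace ℝ (Fin d), 0 ≤ y l → ‖y‖ = R₁ → σ * v y ≤ M)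
    {y : EuclideanSpace ℝ (Fin d)} (hy : 0 ≤ y l) (hy₀ : R₀ ≤ ‖y‖) (hy₁ : ‖y‖ ≤ R₁) :
    σ * v y ≤ M := by
  have hy0 : y ≠ 0 := by rw [← norm_pos_iff]; linarith
  set q := pdist l (1 / 20) 0 y ^ (-1 / 2 : ℝ)
  have hq : 0 < q := Real.rpow_pos_of_pos
    ((norm_pos_iff.2 hy0).trans_le (pdist_zero_bounds l hy).1) _
  refine le_of_forall_pos_le_add fun ε hε => ?_
  obtain ⟨z, hz, hzR, h⟩ := S.annulus_comparison hd hR₀ σ (div_pos hε hq) hy hy₀ hy₁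
  have hzM : σ * v z ≤ M := hzR.elim (h₀ z hz) (h₁ z hz)
  have hz0 : 0 ≤ pdist l (1 / 20) 0 z ^ (-1 / 2 : ℝ) :=
    Real.rpow_nonneg ((norm_nonneg z).trans (pdist_zero_bounds l hz).1) _
  have e : ε / q * q = ε := by field_simp
  have := mul_nonneg (div_pos hε hq).le hz0
  change _ ≤ _ + ε / q * (q - _) at h
  rw [mul_sub] at h
  linarith

/-- A quantitative decay estimate from the unit half sphere to the half sphere of radius two. -/
lemma RegSol.le_of_far (hd : 3 ≤ d) {l : Fin d} {v : EuclideanSpace ℝ (Fin d) → ℝ}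
    {W : Set (EuclideanSpace ℝ (Fin d))} (S : RegSol l v W) {R M L : ℝ} (hR : 2 ≤ R) (σ : ℝ)
    (hLM : L < M)
    (h₀ : ∀ y : EuclideanSpace ℝ (Fin d), 0 ≤ y l → ‖y‖ = 1 → σ * v y ≤ M)
    (h₁ : ∀ y : EuclideanSpace ℝ (Fin d), 0 ≤ y l → ‖y‖ = R → σ * v y ≤ L)
    {y : EuclideanSpace ℝ (Fin d)} (hy : 0 ≤ y l) (hy2 : ‖y‖ = 2) :
    σ * v y ≤ L + 3 / 4 * (M - L) := by
  have hne : ∀ z : EuclideanSpace ℝ (Fin d), 1 ≤ ‖z‖ → z ≠ 0 := fun z hz => by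
    rw [← norm_pos_iff]; linarith
  set k : ℝ := (21 / 20) ^ (-1 / 2 : ℝ) with hk
  have hk0 : 0 < k := Real.rpow_pos_of_pos (by norm_num) _
  have hML : 0 < M - L := sub_pos.2 hLM
  set c : ℝ := (M - L) / k with hc
  have hck : c * k = M - L := by rw [hc]; field_simp
  have hc0 : 0 < c := div_pos hML hk0
  obtain ⟨z, hz, hzR, h⟩ := S.annulus_comparison hd le_rfl σ hc0 hy (by linarith)
    (hy2.trans_le hR)
  have hqy := slow_le l hy (hne y (by linarith))
  rw [hy2] at hqy
  have h2 : (2 : ℝ) ^ (-1 / 2 : ℝ) ≤ 3 / 4 * k := by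
    rw [← Real.rpow_le_rpow_iff (z := 2) (by positivity) (by positivity) (by norm_num),
      Real.mul_rpow (by norm_num) hk0.le, hk, ← Real.rpow_mul (by norm_num),
      ← Real.rpow_mul (by norm_num)]
    norm_num [Real.rpow_neg_one]
  have hqy' : c * pdist l (1 / 20) 0 y ^ (-1 / 2 : ℝ) ≤ 3 / 4 * (M - L) := by
    rw [← hck, ← mul_assoc, mul_comm _ c, mul_assoc]
    exact mul_le_mul_of_nonneg_left (hqy.trans h2) hc0.le
  have hz1 : 1 ≤ ‖z‖ := by rcases hzR with h | h <;> linarith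
  rw [mul_sub] at h
  rcases hzR with hzR | hzR
  · have hqz := le_slow l hz (hne z hz1)
    rw [hzR, mul_one, ← hk] at hqz
    have := mul_le_mul_of_nonneg_left hqz hc0.le
    linarith [h₀ z hz hzR]
  · have : 0 ≤ c * pdist l (1 / 20) 0 z ^ (-1 / 2 : ℝ) :=
      mul_nonneg hc0.le
        (Real.rpow_nonneg ((norm_nonneg z).trans (pdist_zero_bounds l hz).1) _)
    linarith [h₁ z hz hzR]

end Annuli

section Oscillation

variable {d : ℕ}

lemma convex_halfSpace_inter_closedBall (l : Fin d) (x : EuclideanSpace ℝ (Fin d)) (r : ℝ) :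
    Convex ℝ ({y : EuclideanSpace ℝ (Fin d) | 0 ≤ y l} ∩ Metric.closedBall x r) := by
  refine Convex.inter (fun y hy z hz a b ha hb _ => ?_) (convex_closedBall x r)
  simp only [mem_ofPred_eq, PiLp.add_apply, PiLp.smul_apply, smul_eq_mul] at hy hz ⊢
  positivity

/-- The oscillation of a solution on a small half ball, in terms of a bound on a larger region. -/
lemma RegSol.abs_sub_le (hd : 3 ≤ d) {l : Fin d} {v : EuclideanSpace ℝ (Fin d) → ℝ}
    {W : Set (EuclideanSpace ℝ (Fin d))} (S : RegSol l v W) {x y : EuclideanSpace ℝ (Fin d)}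
    {R m M : ℝ} (hR : 2 ≤ R) (hx : 0 ≤ x l) (hxR : ‖x‖ = R)
    (hm : ∀ z : EuclideanSpace ℝ (Fin d), 0 ≤ z l → R / 2 ≤ ‖z‖ → ‖z‖ ≤ 2 * R → m ≤ v z)
    (hM : ∀ z : EuclideanSpace ℝ (Fin d), 0 ≤ z l → R / 2 ≤ ‖z‖ → ‖z‖ ≤ 2 * R → v z ≤ M)
    (hy : 0 ≤ y l) (hyx : ‖y - x‖ ≤ R / 8) :
    |v y - v x| ≤ 16 * 10 ^ 3 * d * ((M - m) / R) * ‖y - x‖ := by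
  have h3 : (3 : ℝ) ≤ d := by exact_mod_cast hd
  have hR0 : 0 < R := by linarith
  have hMm : 0 ≤ M - m := sub_nonneg.2 <|
    (hm x hx (by linarith) (by linarith)).trans (hM x hx (by linarith) (by linarith))
  have hn : ∀ z w : EuclideanSpace ℝ (Fin d), ‖z - x‖ ≤ R / 8 → ‖w - z‖ ≤ 2 * (R / 16) →
      R / 2 ≤ ‖w‖ ∧ ‖w‖ ≤ 2 * R := fun z w hz hw => by
    have h1 : ‖w - x‖ ≤ R / 4 := by
      calc ‖w - x‖ = ‖(w - z) + (z - x)‖ := by rw [sub_add_sub_cancel]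
        _ ≤ ‖w - z‖ + ‖z - x‖ := norm_add_le _ _
        _ ≤ R / 4 := by linarith
    have h2 := abs_le.1 (abs_norm_sub_norm_le w x)
    constructor <;> linarith
  have hz1 : ∀ z : EuclideanSpace ℝ (Fin d), ‖z - x‖ ≤ R / 8 → 1 ≤ ‖z‖ := fun z hz => by
    linarith [(hn z z hz (by simp; positivity)).1]
  have hG : ∀ z ∈ {y : EuclideanSpace ℝ (Fin d) | 0 ≤ y l} ∩ Metric.closedBall x (R / 8),
      ‖fderiv ℝ v z‖ ≤ 16 * 10 ^ 3 * d * ((M - m) / R) := fun z hz => by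
    have hzx : ‖z - x‖ ≤ R / 8 := by simpa [dist_eq_norm] using hz.2
    have h := S.gradient_estimate hd (r := R / 16) (by positivity) hz.1
      (fun w hw hwz => by linarith [(hn z w hzx hwz).1])
      (fun w hw hwz => hm w hw (hn z w hzx hwz).1 (hn z w hzx hwz).2)
      (fun w hw hwz => hM w hw (hn z w hzx hwz).1 (hn z w hzx hwz).2)
    refine le_of_sq_le_sq (h.trans ?_) (by positivity)
    have e : (M - m) / (R / 16) = 16 * ((M - m) / R) := by field_simp
    rw [e]
    have : 0 ≤ ((M - m) / R) ^ 2 := sq_nonneg _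
    nlinarith [mul_nonneg this (by nlinarith : (0 : ℝ) ≤ d ^ 2 - d),
      mul_nonneg this (sq_nonneg (d : ℝ))]
  have hmem : ∀ z : EuclideanSpace ℝ (Fin d), 0 ≤ z l → ‖z - x‖ ≤ R / 8 →
      z ∈ {y : EuclideanSpace ℝ (Fin d) | 0 ≤ y l} ∩ Metric.closedBall x (R / 8) :=
    fun z hz hzx => ⟨hz, by simpa [dist_eq_norm] using hzx⟩
  simpa [Real.norm_eq_abs] using
    (convex_halfSpace_inter_closedBall l x (R / 8)).norm_image_sub_le_of_norm_fderiv_le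
    (fun z hz => ((contDiffAt_two S.isOpen S.smooth (S.mem z hz.1
      (hz1 z (by simpa [dist_eq_norm] using hz.2)))).differentiableAt (by norm_num))) hG
    (hmem x hx (by simp; positivity)) (hmem y hy hyx)

end Oscillation

section Harnack

variable {d : ℕ}

lemma fast_le (l : Fin d) {x y : EuclideanSpace ℝ (Fin d)} {ρ : ℝ} (hρ : 0 < ρ)
    (h : ρ ≤ ‖y - x‖) : pdist l (-1 / 20) x y ^ (-(2 * d) : ℝ) ≤
      (19 / 20 * ρ) ^ (-(2 * d) : ℝ) := by
  have hθ : |(-1 / 20 : ℝ)| ≤ 1 / 20 := by rw [abs_le]; norm_num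
  have h1 := abs_le.1 (abs_pdist_sub_le l hθ x y)
  exact Real.rpow_le_rpow_of_nonpos (by positivity) (by linarith) (by simp)

lemma le_fast (l : Fin d) {x y : EuclideanSpace ℝ (Fin d)} {ρ : ℝ} (h0 : y ≠ x)
    (h : ‖y - x‖ ≤ ρ) : (21 / 20 * ρ) ^ (-(2 * d) : ℝ) ≤
      pdist l (-1 / 20) x y ^ (-(2 * d) : ℝ) := by
  have hθ : |(-1 / 20 : ℝ)| ≤ 1 / 20 := by rw [abs_le]; norm_num
  have h1 := abs_le.1 (abs_pdist_sub_le l hθ x y)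
  exact Real.rpow_le_rpow_of_nonpos (pdist_pos l hθ h0) (by linarith) (by simp)

/-- Comparison on a perforated exterior region with two barriers. -/
lemma RegSol.perforated_comparison (hd : 3 ≤ d) {l : Fin d}
    {v : EuclideanSpace ℝ (Fin d) → ℝ} {W : Set (EuclideanSpace ℝ (Fin d))} (S : RegSol l v W)
    {R₀ ρ ρ' A B : ℝ} (hR₀ : 1 ≤ R₀) (hρ : 0 < ρ) (hA : 0 < A) (hB : 0 < B) (σ : ℝ)
    {x y : EuclideanSpace ℝ (Fin d)} (hx : 0 ≤ x l) (hy : 0 ≤ y l) (hy₀ : R₀ ≤ ‖y‖)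
    (hyρ : ρ ≤ ‖y - x‖) (hyρ' : ‖y - x‖ ≤ ρ') :
    ∃ z : EuclideanSpace ℝ (Fin d), 0 ≤ z l ∧ R₀ ≤ ‖z‖ ∧ ρ ≤ ‖z - x‖ ∧
      (‖z‖ = R₀ ∨ ‖z - x‖ = ρ ∨ ‖z - x‖ = ρ') ∧
      σ * v y + (A * pdist l (-1 / 20) x y ^ (-(2 * d) : ℝ) +
          B * (-1 * pdist l (1 / 20) 0 y ^ (-1 / 2 : ℝ))) ≤
        σ * v z + (A * pdist l (-1 / 20) x z ^ (-(2 * d) : ℝ) +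
          B * (-1 * pdist l (1 / 20) 0 z ^ (-1 / 2 : ℝ))) := by
  have hne : ∀ z : EuclideanSpace ℝ (Fin d), R₀ ≤ ‖z‖ → z ≠ 0 := fun z hz => by
    rw [← norm_pos_iff]; linarith
  have hne' : ∀ z : EuclideanSpace ℝ (Fin d), ρ ≤ ‖z - x‖ → z ≠ x := fun z hz => by
    rw [← sub_ne_zero, ← norm_pos_iff]; linarith
  set K : Set (EuclideanSpace ℝ (Fin d)) :=
    {z | 0 ≤ z l ∧ R₀ ≤ ‖z‖ ∧ ρ ≤ ‖z - x‖ ∧ ‖z - x‖ ≤ ρ'} with hKd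
  have hcx : Continuous fun z : EuclideanSpace ℝ (Fin d) => ‖z - x‖ := by fun_prop
  have hK : IsCompact K := by
    refine (isCompact_closedBall x ρ').of_isClosed_subset
      ((isClosed_halfSpace l).inter ((isClosed_le continuous_const continuous_norm).inter
        ((isClosed_le continuous_const hcx).inter
          (isClosed_le hcx continuous_const)))) fun y hy => ?_
    simpa [dist_eq_norm] using hy.2.2.2
  have hnear : ∀ z ∈ K, ¬ (‖z‖ = R₀ ∨ ‖z - x‖ = ρ ∨ ‖z - x‖ = ρ') →
      ∀ᶠ w in 𝓝 z, 0 ≤ w l → w ∈ K := fun z hz hzΓ => by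
    have h0 : R₀ < ‖z‖ := hz.2.1.lt_of_ne fun h => hzΓ (Or.inl h.symm)
    have h1 : ρ < ‖z - x‖ := hz.2.2.1.lt_of_ne fun h => hzΓ (Or.inr (Or.inl h.symm))
    have h2 : ‖z - x‖ < ρ' := hz.2.2.2.lt_of_ne fun h => hzΓ (Or.inr (Or.inr h))
    filter_upwards [continuous_norm.continuousAt.eventually (lt_mem_nhds h0),
      hcx.continuousAt.eventually (lt_mem_nhds h1),
      hcx.continuousAt.eventually (gt_mem_nhds h2)] with w hw0 hw1 hw2 hw
    exact ⟨hw, hw0.le, hw1.le, hw2.le⟩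
  obtain ⟨z, hz, hzΓ, h⟩ := S.comparison hd hK
    (Γ := {z | ‖z‖ = R₀ ∨ ‖z - x‖ = ρ ∨ ‖z - x‖ = ρ'})
    (φ := fun z => A * pdist l (-1 / 20) x z ^ (-(2 * d) : ℝ) +
      B * (-1 * pdist l (1 / 20) 0 z ^ (-1 / 2 : ℝ)))
    (fun z hz => ⟨hz.1, hR₀.trans hz.2.1⟩)
    ((continuousOn_const.mul (continuousOn_pdist_rpow l (by rw [abs_le]; norm_num)
      (fun z hz => hne' z hz.2.2.1) _)).add
      (continuousOn_const.mul (continuousOn_const.mul (continuousOn_pdist_rpow l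
        (abs_of_pos (by norm_num : (0 : ℝ) < 1 / 20)).le (fun z hz => hne z hz.2.1) _))))
    (fun z hz hzΓ => ⟨hnear z hz hzΓ,
      ((strictSub_fast hd l (hne' z hz.2.2.1) hx).const_mul hA).add
      ((strictSub_slow hd l (hne z hz.2.1) rfl).const_mul hB)⟩) σ ⟨hy, hy₀, hyρ, hyρ'⟩
  exact ⟨z, hz.1, hz.2.1, hz.2.2.1, hzΓ, h⟩

/-- A lower bound on a half sphere from a lower bound on a small half ball. -/
lemma RegSol.spread_positivity (hd : 3 ≤ d) {κ : ℝ} (hκ : 0 < κ) (hκ1 : κ ≤ 1 / 8) :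
    ∃ Λ : ℝ, 4 ≤ Λ ∧ ∃ c₀ : ℝ, 0 < c₀ ∧ c₀ ≤ 1 ∧ ∀ (l : Fin d)
      (v : EuclideanSpace ℝ (Fin d) → ℝ) (W : Set (EuclideanSpace ℝ (Fin d))), RegSol l v W →
      ∀ σ b R₀ R t : ℝ, 1 ≤ R₀ → Λ * R₀ ≤ R → 0 < t →
      (∀ z : EuclideanSpace ℝ (Fin d), 0 ≤ z l → R₀ ≤ ‖z‖ → 0 ≤ σ * v z + b) →
      ∀ x : EuclideanSpace ℝ (Fin d), 0 ≤ x l → ‖x‖ = R →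
      (∀ z : EuclideanSpace ℝ (Fin d), 0 ≤ z l → ‖z - x‖ ≤ κ * R → t ≤ σ * v z + b) →
      ∀ y : EuclideanSpace ℝ (Fin d), 0 ≤ y l → ‖y‖ = R → c₀ * t ≤ σ * v y + b := by
  have h3 : (3 : ℝ) ≤ d := by exact_mod_cast hd
  set e : ℝ := -(2 * d) with he
  have pw : ∀ s : ℝ, 0 < s → 0 < s ^ e := fun s hs => Real.rpow_pos_of_pos hs e
  set δ : ℝ := 1 / 4 * (21 / 10) ^ e / (1 / 2) ^ e with hδ
  have hδ0 : 0 < δ := div_pos (mul_pos (by norm_num) (pw _ (by norm_num))) (pw _ (by norm_num))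
  set γ : ℝ := (19 / 20 * κ) ^ e with hγ
  have hγ0 : 0 < γ := pw _ (by positivity)
  have hγ1 : (21 / 10) ^ e ≤ γ :=
    Real.rpow_le_rpow_of_nonpos (by positivity) (by linarith) (by rw [he]; linarith)
  refine ⟨max 4 (2 / δ ^ 2), le_max_left _ _, γ⁻¹ * (1 / 2 * (21 / 10) ^ e),
    mul_pos (inv_pos.2 hγ0) (mul_pos (by norm_num) (pw _ (by norm_num))), ?_, ?_⟩
  · rw [inv_mul_le_iff₀ hγ0]
    linarith [pw (21 / 10) (by norm_num)]
  intro l v W S σ b R₀ R t hR₀ hR ht hw x hx hxR hball y hy hyR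
  have hR4 : 4 * R₀ ≤ R := (mul_le_mul_of_nonneg_right (le_max_left _ _) (by linarith)).trans hR
  have hRδ : 2 / δ ^ 2 * R₀ ≤ R :=
    (mul_le_mul_of_nonneg_right (le_max_right _ _) (by linarith)).trans hR
  have hRpos : 0 < R := by linarith
  have hR₀pos : 0 < R₀ := by linarith
  by_cases hyκ : ‖y - x‖ ≤ κ * R
  · refine le_trans ?_ (hball y hy hyκ)
    refine mul_le_of_le_one_left ht.le ?_
    rw [inv_mul_le_iff₀ hγ0]
    linarith [pw (21 / 10) (by norm_num)]
  push Not at hyκ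
  set a : ℝ := t * γ⁻¹ with ha
  have ha0 : 0 < a := mul_pos ht (inv_pos.2 hγ0)
  set A : ℝ := a * (R ^ e)⁻¹ with hAd
  have hA0 : 0 < A := mul_pos ha0 (inv_pos.2 (pw R hRpos))
  have hAs : ∀ s : ℝ, 0 < s → A * (s * R) ^ e = a * s ^ e := fun s hs => by
    rw [hAd, Real.mul_rpow hs.le hRpos.le]
    have := (pw R hRpos).ne'
    field_simp
  have hAγ : A * (19 / 20 * (κ * R)) ^ e = t := by
    rw [← mul_assoc, hAs _ (by positivity), ← hγ, ha]
    field_simp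
  set B : ℝ := a * (1 / 2) ^ e * (2 * R₀) ^ (1 / 2 : ℝ) with hBd
  have hB0 : 0 < B := mul_pos (mul_pos ha0 (pw _ (by norm_num)))
    (Real.rpow_pos_of_pos (by positivity) _)
  have hyx : ‖y - x‖ ≤ 2 * R := by
    linarith [norm_sub_le y x]
  obtain ⟨z, hz, hzR₀, hzκ, hzΓ, h⟩ := S.perforated_comparison hd (ρ := κ * R) (ρ' := 4 * R) hR₀
    (by positivity) hA0 hB0 (-σ) hx hy (by linarith) hyκ.le (by linarith)
  have hz0 : z ≠ 0 := by rw [← norm_pos_iff]; linarith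
  have hy0 : y ≠ 0 := by rw [← norm_pos_iff]; linarith
  have hyne : y ≠ x := by
    rw [← sub_ne_zero, ← norm_pos_iff]; linarith [mul_pos hκ hRpos]
  have hwz := hw z hz hzR₀
  have hsz : 0 ≤ B * pdist l (1 / 20) 0 z ^ (-1 / 2 : ℝ) :=
    mul_nonneg hB0.le (Real.rpow_nonneg ((norm_nonneg z).trans (pdist_zero_bounds l hz).1) _)
  have hFz : -σ * v z - b + (A * pdist l (-1 / 20) x z ^ e +
      B * (-1 * pdist l (1 / 20) 0 z ^ (-1 / 2 : ℝ))) ≤ a * (38 / 10) ^ e := by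
    have hp : 0 < a * (38 / 10) ^ e := mul_pos ha0 (pw _ (by norm_num))
    rcases hzΓ with hzΓ | hzΓ | hzΓ
    · have h1 := fast_le l (x := x) (y := z) (ρ := 3 / 4 * R) (by positivity) (by
        linarith [norm_sub_norm_le x z, norm_sub_rev x z])
      have h2 : (19 / 20 * (3 / 4 * R)) ^ e ≤ (1 / 2 * R) ^ e :=
        Real.rpow_le_rpow_of_nonpos (by positivity) (by linarith) (by rw [he]; linarith)
      have h3 := mul_le_mul_of_nonneg_left (h1.trans h2) hA0.le
      rw [hAs _ (by norm_num)] at h3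
      have h4 := le_slow l hz hz0
      rw [hzΓ] at h4
      have h5 : (2 * R₀) ^ (-1 / 2 : ℝ) ≤ (21 / 20 * R₀) ^ (-1 / 2 : ℝ) :=
        Real.rpow_le_rpow_of_nonpos (by positivity) (by linarith) (by norm_num)
      have h6 := mul_le_mul_of_nonneg_left (h5.trans h4) hB0.le
      rw [hBd, mul_assoc, ← Real.rpow_add (by positivity)] at h6
      norm_num at h6
      rw [← hBd] at h6
      norm_num at h3
      linarith
    · have h1 := fast_le l (x := x) (y := z) (ρ := κ * R) (by positivity) hzκ
      have h2 := mul_le_mul_of_nonneg_left h1 hA0.le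
      rw [hAγ] at h2
      have h3 := hball z hz hzΓ.le
      linarith
    · have h1 := fast_le l (x := x) (y := z) (ρ := 4 * R) (by positivity) hzΓ.ge
      have h2 := mul_le_mul_of_nonneg_left h1 hA0.le
      rw [← mul_assoc, hAs _ (by norm_num)] at h2
      norm_num at h2 ⊢
      linarith
  have hgy := mul_le_mul_of_nonneg_left (le_fast l hyne hyx) hA0.le
  rw [← mul_assoc, hAs _ (by norm_num), show (21 / 20 * 2 : ℝ) = 21 / 10 by norm_num] at hgy
  have hsy : B * pdist l (1 / 20) 0 y ^ (-1 / 2 : ℝ) ≤ a * (1 / 4 * (21 / 10) ^ e) := by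
    have h1 := mul_le_mul_of_nonneg_left (slow_le l hy hy0) hB0.le
    rw [hyR] at h1
    refine h1.trans ?_
    have h2 : (2 * R₀) ^ (1 / 2 : ℝ) * R ^ (-1 / 2 : ℝ) ≤ δ := by
      rw [show (-1 / 2 : ℝ) = -(1 / 2) by norm_num, Real.rpow_neg hRpos.le, ← div_eq_mul_inv,
        ← Real.div_rpow (by positivity) hRpos.le, ← Real.sqrt_eq_rpow]
      refine Real.sqrt_le_iff.2 ⟨hδ0.le, ?_⟩
      rw [div_le_iff₀ hRpos]
      rw [div_mul_eq_mul_div, div_le_iff₀ (by positivity)] at hRδ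
      linarith
    calc B * R ^ (-1 / 2 : ℝ) = a * (1 / 2) ^ e * ((2 * R₀) ^ (1 / 2 : ℝ) * R ^ (-1 / 2 : ℝ)) := by
          rw [hBd]; ring
      _ ≤ a * (1 / 2) ^ e * δ :=
          mul_le_mul_of_nonneg_left h2 (mul_pos ha0 (pw _ (by norm_num))).le
      _ = a * (1 / 4 * (21 / 10) ^ e) := by
          rw [hδ]
          have := (pw (1 / 2) (by norm_num)).ne'
          field_simp
  have h38 : (38 / 10 : ℝ) ^ e ≤ 1 / 4 * (21 / 10) ^ e := by
    rw [show (38 / 10 : ℝ) = 21 / 10 * (38 / 21) by norm_num,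
      Real.mul_rpow (by norm_num) (by norm_num), mul_comm]
    refine mul_le_mul_of_nonneg_right ?_ (pw _ (by norm_num)).le
    calc (38 / 21 : ℝ) ^ e ≤ (38 / 21 : ℝ) ^ (-3 : ℝ) :=
          Real.rpow_le_rpow_of_exponent_le (by norm_num) (by rw [he]; linarith)
      _ ≤ 1 / 4 := by
          rw [Real.rpow_neg (by norm_num)]
          norm_num
  have h38' := mul_le_mul_of_nonneg_left h38 ha0.le
  have hfin : γ⁻¹ * (1 / 2 * (21 / 10) ^ e) * t = a * (1 / 2 * (21 / 10) ^ e) := by rw [ha]; ring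
  rw [hfin]
  linarith

end Harnack

section Bounded

variable {d : ℕ} {l : Fin d} {v : EuclideanSpace ℝ (Fin d) → ℝ}
  {W : Set (EuclideanSpace ℝ (Fin d))}

/-- A Harnack inequality on large half spheres. -/
lemma RegSol.harnack (hd : 3 ≤ d) {D : ℝ} (hD : 1 ≤ D) :
    ∃ Λ : ℝ, 4 ≤ Λ ∧ ∃ c₀ : ℝ, 0 < c₀ ∧ ∀ (l : Fin d)
      (v : EuclideanSpace ℝ (Fin d) → ℝ) (W : Set (EuclideanSpace ℝ (Fin d))), RegSol l v W →
      ∀ σ b R₀ R : ℝ, (σ = 1 ∨ σ = -1) → 1 ≤ R₀ → Λ * R₀ ≤ R →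
      (∀ z : EuclideanSpace ℝ (Fin d), 0 ≤ z l → R₀ ≤ ‖z‖ → 0 ≤ σ * v z + b) →
      ∀ x : EuclideanSpace ℝ (Fin d), 0 ≤ x l → ‖x‖ = R → 0 < σ * v x + b →
      (∀ z : EuclideanSpace ℝ (Fin d), 0 ≤ z l → R / 2 ≤ ‖z‖ → ‖z‖ ≤ 2 * R →
        σ * v z + b ≤ D * (σ * v x + b)) →
      ∀ y : EuclideanSpace ℝ (Fin d), 0 ≤ y l → ‖y‖ = R →
        c₀ * (σ * v x + b) ≤ σ * v y + b := by
  have h3 : (3 : ℝ) ≤ d := by exact_mod_cast hd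
  set G : ℝ := 16 * 10 ^ 3 * d * D with hG
  have hG8 : 8 ≤ G := by
    rw [hG]
    nlinarith
  obtain ⟨Λ, hΛ, c₀, hc₀, -, H⟩ := RegSol.spread_positivity (d := d) hd (κ := 1 / (2 * G))
    (by positivity) (by rw [div_le_div_iff₀] <;> linarith)
  refine ⟨Λ, hΛ, c₀ / 2, by positivity, ?_⟩
  intro l v W S σ b R₀ R hσ hR₀ hR hw x hx hxR hs hup y hy hyR
  have hR4 : 4 * R₀ ≤ R := (mul_le_mul_of_nonneg_right hΛ (by linarith)).trans hR
  have hRpos : 0 < R := by linarith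
  set s := σ * v x + b with hsd
  have hball : ∀ z : EuclideanSpace ℝ (Fin d), 0 ≤ z l → ‖z - x‖ ≤ 1 / (2 * G) * R →
      s / 2 ≤ σ * v z + b := fun z hz hzx => by
    have hκ : 1 / (2 * G) * R ≤ R / 8 := by
      rw [div_mul_eq_mul_div, one_mul]
      exact div_le_div_of_nonneg_left hRpos.le (by norm_num) (by linarith)
    have key : |v z - v x| ≤ 16 * 10 ^ 3 * d * (D * s / R) * ‖z - x‖ := by
      rcases hσ with rfl | rfl
      · have := S.abs_sub_le hd (by linarith) hx hxR (m := -b) (M := D * s - b)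
          (fun z hz h1 h2 => by linarith [hw z hz (by linarith)])
          (fun z hz h1 h2 => by linarith [hup z hz h1 h2]) hz (hzx.trans hκ)
        rwa [show D * s - b - -b = D * s by ring] at this
      · have := S.abs_sub_le hd (by linarith) hx hxR (m := b - D * s) (M := b)
          (fun z hz h1 h2 => by linarith [hup z hz h1 h2])
          (fun z hz h1 h2 => by linarith [hw z hz (by linarith)]) hz (hzx.trans hκ)
        rwa [show b - (b - D * s) = D * s by ring] at this
    have e : 16 * 10 ^ 3 * d * (D * s / R) * ‖z - x‖ ≤ s / 2 := by
      calc 16 * 10 ^ 3 * d * (D * s / R) * ‖z - x‖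
          ≤ 16 * 10 ^ 3 * d * (D * s / R) * (1 / (2 * G) * R) :=
            mul_le_mul_of_nonneg_left hzx (by positivity)
        _ = G * s / R * (1 / (2 * G) * R) := by rw [hG]; ring
        _ = s / 2 := by field_simp
    have k := abs_le.1 (key.trans e)
    rcases hσ with rfl | rfl <;> linarith
  have := H l v W S σ b R₀ R (s / 2) hR₀ hR (by positivity) hw x hx hxR hball y hy hyR
  linarith

lemma exists_mem_sphere (l : Fin d) {R : ℝ} (hR : 0 ≤ R) :
    ∃ x : EuclideanSpace ℝ (Fin d), 0 ≤ x l ∧ ‖x‖ = R :=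
  ⟨EuclideanSpace.single l R, by simpa using hR, by simpa using hR⟩

lemma isCompact_halfSphere (l : Fin d) (R : ℝ) :
    IsCompact {y : EuclideanSpace ℝ (Fin d) | 0 ≤ y l ∧ ‖y‖ = R} := by
  have := isCompact_halfAnnulus l R R
  simpa only [le_antisymm_iff, and_comm (a := R ≤ _)] using this

lemma RegSol.exists_max (S : RegSol l v W) {R : ℝ} (hR : 1 ≤ R) (σ : ℝ) :
    ∃ x : EuclideanSpace ℝ (Fin d), 0 ≤ x l ∧ ‖x‖ = R ∧
      ∀ y : EuclideanSpace ℝ (Fin d), 0 ≤ y l → ‖y‖ = R → σ * v y ≤ σ * v x := by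
  obtain ⟨x₀, hx₀, hx₀R⟩ := exists_mem_sphere l (zero_le_one.trans hR)
  have hc : ContinuousOn (fun z => σ * v z) {y : EuclideanSpace ℝ (Fin d) | 0 ≤ y l ∧ ‖y‖ = R} :=
    continuousOn_const.mul (S.smooth.continuousOn.mono fun z hz =>
      S.mem z hz.1 (hR.trans hz.2.ge))
  obtain ⟨x, hx, hmax⟩ := (isCompact_halfSphere l R).exists_isMaxOn ⟨x₀, hx₀, hx₀R⟩ hc
  exact ⟨x, hx.1, hx.2, fun y hy hyR => hmax ⟨hy, hyR⟩⟩

/-- Solutions with small gradient grow at most linearly. -/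
lemma RegSol.linear_growth (hd : 3 ≤ d) (S : RegSol l v W) (σ : ℝ) (hσ : σ = 1 ∨ σ = -1) :
    ∃ a : ℝ, ∀ y : EuclideanSpace ℝ (Fin d), 0 ≤ y l → 1 ≤ ‖y‖ → σ * v y ≤ a + ‖y‖ := by
  obtain ⟨x, -, -, hmax⟩ := S.exists_max le_rfl σ
  refine ⟨σ * v x, fun y hy hy1 => ?_⟩
  have hy0 : 0 < ‖y‖ := by linarith
  set e : EuclideanSpace ℝ (Fin d) := ‖y‖⁻¹ • y with he
  have hmem : ∀ t ∈ Icc (1 : ℝ) ‖y‖, 0 ≤ (t • e) l ∧ ‖t • e‖ = t := fun t ht => by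
    have ht0 : 0 ≤ t := zero_le_one.trans ht.1
    refine ⟨?_, ?_⟩
    · simp only [he, PiLp.smul_apply, smul_eq_mul]
      positivity
    · rw [he, norm_smul, norm_smul, norm_inv, norm_norm, Real.norm_of_nonneg ht0,
        inv_mul_cancel₀ hy0.ne', mul_one]
  have he1 : ‖e‖ = 1 := by simpa using (hmem 1 ⟨le_rfl, hy1⟩).2
  have hye : ‖y‖ • e = y := by rw [he, smul_smul, mul_inv_cancel₀ hy0.ne', one_smul]
  have hder : ∀ t ∈ Icc (1 : ℝ) ‖y‖, HasDerivWithinAt (fun t : ℝ => v (t • e))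
      (fderiv ℝ v (t • e) e) (Icc 1 ‖y‖) t := fun t ht => by
    have h1 : HasDerivAt (fun t : ℝ => t • e) e t := by
      simpa using (hasDerivAt_id t).smul_const e
    exact ((((contDiffAt_two S.isOpen S.smooth (S.mem _ (hmem t ht).1
      (ht.1.trans (hmem t ht).2.ge))).differentiableAt
        (by norm_num)).hasFDerivAt).comp_hasDerivAt t h1).hasDerivWithinAt
  have hb : ∀ t ∈ Icc (1 : ℝ) ‖y‖, ‖fderiv ℝ v (t • e) e‖ ≤ 1 := fun t ht => by
    refine ((fderiv ℝ v (t • e)).le_opNorm e).trans ?_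
    rw [he1, mul_one]
    exact (S.small _ (hmem t ht).1 (ht.1.trans (hmem t ht).2.ge)).trans
      ((eta_le hd).trans (by norm_num))
  have h := (convex_Icc (1 : ℝ) ‖y‖).norm_image_sub_le_of_norm_hasDerivWithin_le hder hb
    ⟨le_rfl, hy1⟩ ⟨hy1, le_rfl⟩
  simp only [hye, one_smul, one_mul, Real.norm_eq_abs] at h
  rw [abs_of_nonneg (sub_nonneg.2 hy1)] at h
  have h1 := abs_le.1 h
  have h2 := hmax e (by simpa using (hmem 1 ⟨le_rfl, hy1⟩).1) he1
  rcases hσ with rfl | rfl <;> linarith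

/-- A solution bounded on one side is bounded on the other side. -/
lemma RegSol.bounded_of_bounded (hd : 3 ≤ d) (S : RegSol l v W) {σ b : ℝ} (hσ : σ = 1 ∨ σ = -1)
    (hw : ∀ z : EuclideanSpace ℝ (Fin d), 0 ≤ z l → 1 ≤ ‖z‖ → 0 ≤ σ * v z + b) :
    ∃ M : ℝ, ∀ y : EuclideanSpace ℝ (Fin d), 0 ≤ y l → 1 ≤ ‖y‖ → σ * v y ≤ M := by
  have p1 : ∀ k : ℕ, (1 : ℝ) ≤ 2 ^ k := fun k => one_le_pow₀ (by norm_num)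
  choose x hx hxR hmax using fun k : ℕ => S.exists_max (p1 k) σ
  have hxw : ∀ k, 0 ≤ σ * v (x k) + b := fun k => hw _ (hx k) ((p1 k).trans (hxR k).ge)
  have mp : ∀ i j : ℕ, ∀ y : EuclideanSpace ℝ (Fin d), 0 ≤ y l → (2 : ℝ) ^ i ≤ ‖y‖ →
      ‖y‖ ≤ 2 ^ j → σ * v y ≤ max (σ * v (x i)) (σ * v (x j)) := fun i j y hy hyi hyj =>
    S.le_of_spheres hd (p1 i) σ (fun z hz hzR => (hmax i z hz hzR).trans (le_max_left _ _))
      (fun z hz hzR => (hmax j z hz hzR).trans (le_max_right _ _)) hy hyi hyj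
  have mp' : ∀ i k j : ℕ, i ≤ k → k ≤ j →
      σ * v (x k) ≤ max (σ * v (x i)) (σ * v (x j)) := fun i k j hik hkj =>
    mp i j (x k) (hx k) ((pow_le_pow_right₀ (by norm_num) hik).trans (hxR k).ge)
      ((hxR k).le.trans (pow_le_pow_right₀ (by norm_num) hkj))
  by_contra! hcon
  have hunb : ∀ T : ℝ, ∃ k, T < σ * v (x k) := fun T => by
    obtain ⟨y, hy, hy1, hyT⟩ := hcon T
    obtain ⟨j, hj⟩ := pow_unbounded_of_one_lt ‖y‖ (one_lt_two (α := ℝ))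
    rcases lt_max_iff.1 (hyT.trans_le (mp 0 j y hy (by simpa using hy1) hj.le)) with h | h
    exacts [⟨0, h⟩, ⟨j, h⟩]
  obtain ⟨k₀, hk₀⟩ := hunb (σ * v (x 0))
  have hge : ∀ j, k₀ ≤ j → σ * v (x k₀) ≤ σ * v (x j) := fun j hj =>
    (le_max_iff.1 (mp' 0 k₀ j (Nat.zero_le _) hj)).resolve_left hk₀.not_ge
  have hmono : ∀ k j, k₀ ≤ k → k ≤ j → σ * v (x k) ≤ σ * v (x j) := fun k j hk hj =>
    (le_max_iff.1 (mp' 0 k j (Nat.zero_le _) hj)).resolve_left (hk₀.trans_le (hge k hk)).not_ge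
  have hpos : ∀ k, k₀ ≤ k → 0 < σ * v (x k) + b := fun k hk => by
    linarith [hge k hk, hxw 0]
  have hunb' : ∀ T : ℝ, ∃ k, k₀ ≤ k ∧ T < σ * v (x k) := fun T => by
    obtain ⟨k, hk⟩ := hunb T
    rcases le_total k₀ k with h | h
    · exact ⟨k, h, hk⟩
    · refine ⟨k₀, le_rfl, ?_⟩
      rcases le_max_iff.1 (mp' 0 k k₀ (Nat.zero_le _) h) with h' | h' <;> linarith
  obtain ⟨a, ha⟩ := S.linear_growth hd σ hσ
  have hslow : ∀ N, k₀ ≤ N → ∃ k, N ≤ k ∧ σ * v (x (k + 1)) + b ≤ 4 * (σ * v (x k) + b) := by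
    intro N hN
    by_contra! hc
    have hgrow : ∀ i : ℕ, (4 : ℝ) ^ i * (σ * v (x N) + b) ≤ σ * v (x (N + i)) + b := by
      intro i
      induction i with
      | zero => simp
      | succ i ih =>
        have := hc (N + i) (Nat.le_add_right _ _)
        rw [pow_succ, ← add_assoc]
        linarith
    have hp := hpos N hN
    obtain ⟨i, hi⟩ := pow_unbounded_of_one_lt ((|a + b| + 2 ^ N) / (σ * v (x N) + b))
      (one_lt_two (α := ℝ))
    rw [div_lt_iff₀ hp] at hi
    have h1 := hgrow i
    have h2 := ha (x (N + i)) (hx _) ((p1 _).trans (hxR _).ge)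
    rw [hxR, pow_add] at h2
    have h3 := mul_lt_mul_of_pos_left hi (zero_lt_one.trans_le (p1 i))
    rw [← mul_assoc, ← mul_pow, mul_add] at h3
    norm_num at h3
    have h4 := mul_le_mul_of_nonneg_right (p1 i) (abs_nonneg (a + b))
    have h5 := le_abs_self (a + b)
    linarith
  obtain ⟨Λ, hΛ, c₀, hc₀, H⟩ := RegSol.harnack (d := d) hd (D := 4) (by norm_num)
  have hfar : ∀ T : ℝ, 0 < T → ∃ R : ℝ, 2 ≤ R ∧ ∀ y : EuclideanSpace ℝ (Fin d), 0 ≤ y l →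
      ‖y‖ = R → -σ * v y ≤ b - T := fun T hT => by
    obtain ⟨k₁, hk₁, hk₁T⟩ := hunb' (T / c₀ - b)
    obtain ⟨k₂, hk₂⟩ := pow_unbounded_of_one_lt Λ (one_lt_two (α := ℝ))
    obtain ⟨k, hk, hk4⟩ := hslow (max (k₁ + 1) k₂) (by omega)
    obtain ⟨n, rfl⟩ : ∃ n, k = n + 1 := ⟨k - 1, by omega⟩
    have hkk : k₁ ≤ n := by omega
    have hkΛ : Λ ≤ 2 ^ (n + 1) :=
      hk₂.le.trans (pow_le_pow_right₀ (by norm_num) ((le_max_right _ _).trans hk))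
    refine ⟨2 ^ (n + 1), by linarith, fun y hy hyR => ?_⟩
    have hp := hpos (n + 1) (by omega)
    have h := H l v W S σ b 1 (2 ^ (n + 1)) hσ le_rfl (by linarith) hw (x (n + 1)) (hx _) (hxR _)
      hp (fun z hz h1 h2 => by
        have h3 := mp n (n + 2) z hz (by rw [pow_succ] at h1; linarith) (by
          rw [pow_succ _ (n + 1)]; linarith)
        rcases le_max_iff.1 h3 with h | h
        · have := hmono n (n + 1) (by omega) (by omega)
          linarith
        · linarith [hk4, h, show x (n + 2) = x (n + 1 + 1) from rfl]) y hy hyR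
    have h4 := hmono k₁ (n + 1) hk₁ (by omega)
    have h5 : T < c₀ * (σ * v (x k₁) + b) := by
      rw [← div_lt_iff₀' hc₀]; linarith
    have h6 := mul_le_mul_of_nonneg_left h4 hc₀.le
    linarith
  obtain ⟨y, hy, hyR⟩ := exists_mem_sphere l (zero_le_two (α := ℝ))
  have hT : 0 < 4 * (σ * v y + b) + 1 := by
    linarith [hw y hy (by linarith)]
  obtain ⟨R, hR, h⟩ := hfar _ hT
  have := S.le_of_far hd hR (-σ) (M := b) (sub_lt_self b hT)
    (fun z hz hz1 => by linarith [hw z hz hz1.ge]) h hy hyR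
  linarith

end Bounded

section Limit

variable {d : ℕ} {v : EuclideanSpace ℝ (Fin d) → ℝ} {W : Set (EuclideanSpace ℝ (Fin d))}

lemma eventually_farFilter (h0 : 0 < d) {P : EuclideanSpace ℝ (Fin d) → Prop} :
    (∀ᶠ y in farFilter d h0, P y) ↔ ∃ R : ℝ, 1 ≤ R ∧
      ∀ y : EuclideanSpace ℝ (Fin d), 0 ≤ y (lastIdx d h0) → R ≤ ‖y‖ → P y := by
  rw [farFilter, eventually_inf_principal, eventually_comap]
  simp only [eventually_atTop]
  constructor
  · rintro ⟨a, ha⟩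
    exact ⟨max a 1, le_max_right _ _, fun y hy hyR => ha ‖y‖ ((le_max_left _ _).trans hyR) y rfl
      ⟨hy, (le_max_right _ _).trans hyR⟩⟩
  · rintro ⟨R, -, h⟩
    exact ⟨R, fun t ht y hyt hy => h y hy.1 (hyt.symm ▸ ht)⟩

lemma farFilter_neBot (h0 : 0 < d) : (farFilter d h0).NeBot := by
  refine ⟨fun h => ?_⟩
  have h1 : ∀ᶠ y in farFilter d h0, False := by rw [h]; exact eventually_bot
  obtain ⟨R, hR, h2⟩ := (eventually_farFilter h0).1 h1
  obtain ⟨x, hx, hxR⟩ := exists_mem_sphere (lastIdx d h0) (zero_le_one.trans hR)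
  exact h2 x hx hxR.ge

/-- Bounded exterior solutions converge at infinity. -/
lemma RegSol.exists_tendsto (hd : 3 ≤ d) (h0 : 0 < d) (S : RegSol (lastIdx d h0) v W) {M : ℝ}
    (hM : ∀ y : EuclideanSpace ℝ (Fin d), 0 ≤ y (lastIdx d h0) → 1 ≤ ‖y‖ → |v y| ≤ M) :
    ∃ L : ℝ, Tendsto v (farFilter d h0) (𝓝 L) := by
  set l := lastIdx d h0
  set F := farFilter d h0
  have : F.NeBot := farFilter_neBot h0
  have hu : F.IsBoundedUnder (· ≤ ·) v := isBoundedUnder_of_eventually_le (a := M)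
    ((eventually_farFilter h0).2 ⟨1, le_rfl, fun y hy hy1 => (abs_le.1 (hM y hy hy1)).2⟩)
  have hl : F.IsBoundedUnder (· ≥ ·) v := isBoundedUnder_of_eventually_ge (a := -M)
    ((eventually_farFilter h0).2 ⟨1, le_rfl, fun y hy hy1 => (abs_le.1 (hM y hy hy1)).1⟩)
  refine ⟨limsup v F, tendsto_of_le_liminf_of_limsup_le ?_ le_rfl hu hl⟩
  by_contra! hlt
  obtain ⟨Λ, hΛ, c₀, hc₀, H⟩ := RegSol.harnack (d := d) hd (D := 2) (by norm_num)
  set D := limsup v F - liminf v F with hD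
  have hD0 : 0 < D := sub_pos.2 hlt
  obtain ⟨ε, hε, hε1, hε2⟩ : ∃ ε : ℝ, 0 < ε ∧ ε ≤ D / 2 ∧ ε ≤ c₀ * D / 2 :=
    ⟨min (D / 2) (c₀ * D / 2), lt_min (by positivity) (by positivity), min_le_left _ _,
      min_le_right _ _⟩
  obtain ⟨R₀, hR₀, hlow⟩ := (eventually_farFilter h0).1
    (eventually_lt_of_lt_liminf (sub_lt_self (liminf v F) hε) hl)
  obtain ⟨R₁, hR₁, hupp⟩ := (eventually_farFilter h0).1
    (eventually_lt_of_limsup_lt (lt_add_of_pos_right (limsup v F) hε) hu)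
  have hfreq := frequently_lt_of_lt_limsup hl.isCoboundedUnder_le
    (sub_lt_self (limsup v F) hε)
  have hsph : ∀ T : ℝ, 1 ≤ T → ∃ R, T ≤ R ∧ ∀ y : EuclideanSpace ℝ (Fin d), 0 ≤ y l → ‖y‖ = R →
      -1 * v y ≤ -(liminf v F + c₀ * D / 2) := by
    intro T hT
    obtain ⟨x, ⟨hx, hx1, hx2, hx3⟩, hxv⟩ := (((eventually_farFilter h0).2
      ⟨max T (max (Λ * R₀) (2 * R₁)), hT.trans (le_max_left _ _), fun y hy hyR =>
        (⟨hy, (le_max_left _ _).trans hyR,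
          (le_max_left _ _).trans ((le_max_right _ _).trans hyR),
          (le_max_right _ _).trans ((le_max_right _ _).trans hyR)⟩ :
          0 ≤ y l ∧ T ≤ ‖y‖ ∧ Λ * R₀ ≤ ‖y‖ ∧ 2 * R₁ ≤ ‖y‖)⟩).and_frequently hfreq).exists
    refine ⟨‖x‖, hx1, fun y hy hyx => ?_⟩
    have h := H l v W S 1 (-(liminf v F - ε)) R₀ ‖x‖ (Or.inl rfl) hR₀ hx2
      (fun z hz hzR => by linarith [hlow z hz hzR]) x hx rfl (by linarith)
      (fun z hz h1 h2 => by linarith [hupp z hz (by linarith)]) y hy hyx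
    have h2 : c₀ * D ≤ c₀ * (1 * v x + -(liminf v F - ε)) :=
      mul_le_mul_of_nonneg_left (by linarith) hc₀.le
    linarith
  obtain ⟨R₂, hR₂, hs₂⟩ := hsph 1 le_rfl
  have hev : ∀ᶠ y in F, liminf v F + c₀ * D / 2 ≤ v y :=
    (eventually_farFilter h0).2 ⟨R₂, hR₂, fun y hy hyR => by
      obtain ⟨R₃, hR₃, hs₃⟩ := hsph ‖y‖ (hR₂.trans hyR)
      have := S.le_of_spheres hd hR₂ (-1) hs₂ hs₃ hy hyR hR₃
      linarith⟩
  have := le_liminf_of_le hu.isCoboundedUnder_ge hev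
  have : 0 < c₀ * D := by positivity
  linarith

/-- The limit at infinity is controlled by the maxima over two half spheres. -/
lemma RegSol.limit_bound (hd : 3 ≤ d) (h0 : 0 < d) (S : RegSol (lastIdx d h0) v W) {L : ℝ}
    (hL : Tendsto v (farFilter d h0) (𝓝 L)) (σ : ℝ) {x₁ x₂ : EuclideanSpace ℝ (Fin d)}
    (h₁ : ∀ y : EuclideanSpace ℝ (Fin d), 0 ≤ y (lastIdx d h0) → ‖y‖ = 1 → σ * v y ≤ σ * v x₁)
    (hx₂ : 0 ≤ x₂ (lastIdx d h0)) (hx₂R : ‖x₂‖ = 2) :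
    σ * v x₁ - 4 * max (σ * v x₁ - σ * v x₂) 0 ≤ σ * L := by
  by_contra! hlt
  obtain ⟨ε, hε, he⟩ : ∃ ε : ℝ, 0 < ε ∧
      ε = σ * v x₁ - 4 * max (σ * v x₁ - σ * v x₂) 0 - σ * L := ⟨_, sub_pos.2 hlt, rfl⟩
  have m1 := le_max_left (σ * v x₁ - σ * v x₂) 0
  have m2 := le_max_right (σ * v x₁ - σ * v x₂) 0
  obtain ⟨R, hR, hfar⟩ := (eventually_farFilter h0).1
    ((hL.const_mul σ).eventually (gt_mem_nhds (by linarith : σ * L < σ * L + ε / 2)))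
  have := S.le_of_far hd (le_max_left 2 R) σ (M := σ * v x₁) (L := σ * L + ε / 2) (by linarith) h₁
    (fun y hy hyR => (hfar y hy ((le_max_right _ _).trans hyR.ge)).le) hx₂ hx₂R
  linarith

lemma exists_regSol (hd : 3 ≤ d) (h0 : 0 < d) (hv : IsHodSol d h0 v (extDom d h0))
    (hg : ∀ y ∈ extDom d h0, ‖fderiv ℝ v y‖ ≤ eta d) : ∃ W, RegSol (lastIdx d h0) v W := by
  obtain ⟨⟨W, hW, hUW, hs⟩, heq, hbd⟩ := hv
  refine ⟨W, hW, fun y hy hy1 => hUW ⟨hy, hy1⟩, hs, fun y hy hy1 => hg y ⟨hy, hy1⟩,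
    fun y hy hy1 => ?_, fun y hy hy1 => ?_⟩
  · have hy' : y ∈ extDom d h0 := ⟨hy.le, hy1⟩
    have hp := (Hodograph.abs_pd_le v y (lastIdx d h0)).trans (hg y hy')
    have h1 := eta_le hd
    have hne : 1 + pd (lastIdx d h0) v y ≠ 0 := by linarith [abs_le.1 hp]
    rw [← hodA_contract h0 (fun i => pd i v y) (fun i j => pd j (pd i v) y)
      (fun i j => pd_comm (contDiffAt_two hW hs (hUW hy')) j i) hne]
    exact mul_eq_zero_of_right _ (heq y hy' hy)
  · have hy' : y ∈ extDom d h0 := ⟨hy.ge, hy1⟩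
    have h := hbd y hy' hy
    have ht : tangSq d h0 (fun m => pd m v y) = tq (lastIdx d h0) (fun m => pd m v y) := by
      refine Finset.sum_congr rfl fun i _ => ?_
      unfold tg
      split_ifs <;> simp
    change pd (lastIdx d h0) v y = √(1 + tangSq d h0 fun m => pd m v y) - 1 at h
    rw [ht] at h
    have h2 := Real.sq_sqrt (by linarith [tq_nonneg (lastIdx d h0) fun m => pd m v y] :
      0 ≤ 1 + tq (lastIdx d h0) fun m => pd m v y)
    rw [show √(1 + tq (lastIdx d h0) fun m => pd m v y) = 1 + pd (lastIdx d h0) v y by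
      linarith] at h2
    rw [bw]
    linarith

end Limit

end Hodograph

/-- One-sided bounded exterior solutions in `d ≥ 3` are bounded, have a limit at infinity, and
the limit is controlled by the boundary values. -/
theorem stmt6 (d : ℕ) (hd : 3 ≤ d) :
    ∃ η₀ : ℝ, 0 < η₀ ∧ ∃ C : ℝ, 1 ≤ C ∧
      ∀ v : EuclideanSpace ℝ (Fin d) → ℝ,
        IsHodSol d (by omega) v (extDom d (by omega)) →
        (∀ y ∈ extDom d (by omega), ‖fderiv ℝ v y‖ ≤ η₀) →
        ((∃ M : ℝ, ∀ y ∈ extDom d (by omega), v y ≤ M) ∨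
         (∃ m : ℝ, ∀ y ∈ extDom d (by omega), m ≤ v y)) →
        (∃ M : ℝ, ∀ y ∈ extDom d (by omega), |v y| ≤ M) ∧
        ∃ L : ℝ, Filter.Tendsto v (farFilter d (by omega)) (nhds L) ∧
          sSup (v '' upSphere d (by omega) 1) -
              C * max (sSup (v '' upSphere d (by omega) 1) -
                sSup (v '' upSphere d (by omega) 2)) 0
            ≤ L ∧
          L ≤ sInf (v '' upSphere d (by omega) 1) +
              C * max (sInf (v '' upSphere d (by omega) 2) -
                sInf (v '' upSphere d (by omega) 1)) 0 := by
  have h0 : 0 < d := by omega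
  refine ⟨Hodograph.eta d, Hodograph.eta_pos hd, 4, by norm_num, fun v hv hg hb => ?_⟩
  obtain ⟨W, S⟩ := Hodograph.exists_regSol hd h0 hv hg
  obtain ⟨M, hM⟩ : ∃ M : ℝ, ∀ y ∈ extDom d h0, |v y| ≤ M := by
    rcases hb with ⟨b, hb⟩ | ⟨b, hb⟩
    · obtain ⟨M, hM⟩ := S.bounded_of_bounded hd (σ := -1) (b := b) (Or.inr rfl)
        fun z hz hz1 => by linarith [hb z ⟨hz, hz1⟩]
      exact ⟨max b M, fun y hy => abs_le'.2 ⟨(hb y hy).trans (le_max_left _ _),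
        le_trans (by linarith [hM y hy.1 hy.2]) (le_max_right b M)⟩⟩
    · obtain ⟨M, hM⟩ := S.bounded_of_bounded hd (σ := 1) (b := -b) (Or.inl rfl)
        fun z hz hz1 => by linarith [hb z ⟨hz, hz1⟩]
      exact ⟨max M (-b), fun y hy => abs_le'.2
        ⟨le_trans (by linarith [hM y hy.1 hy.2]) (le_max_left M (-b)),
          (neg_le_neg (hb y hy)).trans (le_max_right _ _)⟩⟩
  refine ⟨⟨M, hM⟩, ?_⟩
  obtain ⟨L, hL⟩ := S.exists_tendsto hd h0 fun y hy hy1 => hM y ⟨hy, hy1⟩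
  have hmax : ∀ R : ℝ, 1 ≤ R → ∃ x ∈ upSphere d h0 R,
      sSup (v '' upSphere d h0 R) = v x ∧ ∀ y ∈ upSphere d h0 R, v y ≤ v x := fun R hR => by
    obtain ⟨x, hx, hxR, h⟩ := S.exists_max hR 1
    have h' : ∀ y ∈ upSphere d h0 R, v y ≤ v x := fun y hy => by linarith [h y hy.1 hy.2]
    exact ⟨x, ⟨hx, hxR⟩, IsGreatest.csSup_eq ⟨mem_image_of_mem v ⟨hx, hxR⟩,
      forall_mem_image.2 h'⟩, h'⟩
  have hmin : ∀ R : ℝ, 1 ≤ R → ∃ x ∈ upSphere d h0 R,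
      sInf (v '' upSphere d h0 R) = v x ∧ ∀ y ∈ upSphere d h0 R, v x ≤ v y := fun R hR => by
    obtain ⟨x, hx, hxR, h⟩ := S.exists_max hR (-1)
    have h' : ∀ y ∈ upSphere d h0 R, v x ≤ v y := fun y hy => by linarith [h y hy.1 hy.2]
    exact ⟨x, ⟨hx, hxR⟩, IsLeast.csInf_eq ⟨mem_image_of_mem v ⟨hx, hxR⟩,
      forall_mem_image.2 h'⟩, h'⟩
  refine ⟨L, hL, ?_, ?_⟩
  · obtain ⟨x₁, -, e₁, h₁⟩ := hmax 1 le_rfl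
    obtain ⟨x₂, hx₂, e₂, -⟩ := hmax 2 one_le_two
    have := S.limit_bound hd h0 hL 1 (x₁ := x₁)
      (fun y hy hy1 => by linarith [h₁ y ⟨hy, hy1⟩]) hx₂.1 hx₂.2
    rw [e₁, e₂]
    simpa only [one_mul] using this
  · obtain ⟨x₁, -, e₁, h₁⟩ := hmin 1 le_rfl
    obtain ⟨x₂, hx₂, e₂, -⟩ := hmin 2 one_le_two
    have := S.limit_bound hd h0 hL (-1) (x₁ := x₁)
      (fun y hy hy1 => by linarith [h₁ y ⟨hy, hy1⟩]) hx₂.1 hx₂.2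
    rw [e₁, e₂]
    rw [show -1 * v x₁ - -1 * v x₂ = v x₂ - v x₁ by ring] at this
    linarith
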